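/- arXiv:1105.6137 — 9 statements merged into one kernel-verified Lean document; each statement's English description precedes it below -/
import Mathlib

section
/- Let ω, η ∈ Ω± be such that K(ω) and K(η) have neither upper nor lower bounds. Let κ₁ : ℤ → K(ω) and κ₂ : ℤ → K(η) be increasing bijections, κ = κ₁×κ₂ : ℤ² → K̄ where K̄ = K(ω)×K(η), let τ = τ_{ω,η} and τ' = τ ∘ κ, and let 𝒞 and 𝒞' be the curve following maps of τ and τ' respectively. Then (1) every point of K̄×N returns to K̄×N under positive iteration of 𝒞, so the first return map 𝒞̂ of 𝒞 to K̄×N is defined on all of K̄×N; and (2) defining κ̃ : ℤ²×N → K̄×N by κ̃((m,n),v) = (κ(m,n),v), one has 𝒞̂ ∘ κ̃ = κ̃ ∘ 𝒞'. -/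
/-- `Ω± = {1,−1}^ℤ` (signs modeled by `ℤˣ`). -/
abbrev Om : Type := ℤ → ℤˣ

/-- `N = {(1,0), (−1,0), (0,1), (0,−1)} ⊂ ℤ²`. -/
def Nset : Set (ℤ × ℤ) := {(1, 0), (-1, 0), (0, 1), (0, -1)}

/-- `K(ω) = {n : ¬(ω_n = −1 ∧ ω_{n+1} = 1) ∧ ¬(ω_{n−1} = −1 ∧ ω_n = 1)}`. -/
def Kset (ω : Om) : Set ℤ :=
  {n : ℤ | ¬(ω n = -1 ∧ ω (n+1) = 1) ∧ ¬(ω (n-1) = -1 ∧ ω n = 1)}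

/-- The curve following map of `τ : ℤ² → {1,−1}`:
`𝒞((m,n),(a,b)) = ((m+sb, n+sa), (sb,sa))` where `s = τ(m,n)`. -/
def curve (τ : ℤ × ℤ → ℤˣ) (p : (ℤ × ℤ) × (ℤ × ℤ)) : (ℤ × ℤ) × (ℤ × ℤ) :=
  ((p.1.1 + (τ p.1 : ℤ) * p.2.2, p.1.2 + (τ p.1 : ℤ) * p.2.1),
   ((τ p.1 : ℤ) * p.2.2, (τ p.1 : ℤ) * p.2.1))

theorem mem_Kset_iff (ω : Om) (n : ℤ) (c : ℤˣ) :
    n ∈ Kset ω ↔ ¬(ω n = -c ∧ ω (n + c) = c) ∧ ¬(ω (n - c) = -c ∧ ω n = c) := by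
  rcases Int.units_eq_one_or c with rfl | rfl
  · simp [Kset]
  · simp only [Kset, Set.mem_ofPred_eq, Units.val_neg, Units.val_one, neg_neg, sub_neg_eq_add,
      ← sub_eq_add_neg]
    tauto

/-- At a kept index, moving one step against the sign does not change the sign. -/
theorem apply_sub_self_of_mem_Kset {η : Om} {n : ℤ} (hn : n ∈ Kset η) :
    η (n - η n) = η n := by
  have h := ((mem_Kset_iff η n (η n)).1 hn).2
  rcases Int.units_eq_one_or (η (n - η n)) with h' | h' <;>
    rcases Int.units_eq_one_or (η n) with h'' | h'' <;> simp_all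

/-- A removed pair of columns is crossed in four steps. -/
theorem curve_iterate_cross_pair {ω η : Om} {x n : ℤ} {c : ℤˣ} (hx : ω x = -c)
    (hx' : ω (x + c) = c) (hn : n ∈ Kset η) :
    let F := curve (fun q => ω q.1 * η q.2)
    F^[1] ((x, n), (↑c, 0)) = ((x, n - η n), (0, -↑(η n))) ∧
    F^[2] ((x, n), (↑c, 0)) = ((x + c, n - η n), (↑c, 0)) ∧
    F^[3] ((x, n), (↑c, 0)) = ((x + c, n), (0, ↑(η n))) ∧
    F^[4] ((x, n), (↑c, 0)) = ((x + c + c, n), (↑c, 0)) := by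
  intro F
  have h := apply_sub_self_of_mem_Kset hn
  have hc : (c : ℤ) * c = 1 := by rw [← Units.val_mul, Int.units_mul_self, Units.val_one]
  have he : (η n : ℤ) * η n = 1 := by rw [← Units.val_mul, Int.units_mul_self, Units.val_one]
  have h1 : F ((x, n), (↑c, 0)) = ((x, n - η n), (0, -↑(η n))) := by
    simp only [F, curve, hx, Units.val_mul, Units.val_neg, Prod.mk.injEq]
    grind
  have h2 : F ((x, n - η n), (0, -↑(η n))) = ((x + c, n - η n), (↑c, 0)) := by
    simp only [F, curve, hx, h, Units.val_mul, Units.val_neg, Prod.mk.injEq]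
    grind
  have h3 : F ((x + c, n - η n), (↑c, 0)) = ((x + c, n), (0, ↑(η n))) := by
    simp only [F, curve, hx', h, Units.val_mul, Prod.mk.injEq]
    grind
  have h4 : F ((x + c, n), (0, ↑(η n))) = ((x + c + c, n), (↑c, 0)) := by
    simp only [F, curve, hx', Units.val_mul, Prod.mk.injEq]
    grind
  simp only [Function.iterate_succ_apply, Function.iterate_zero_apply, h1, h2, h3, h4, and_self]

/-- Entering a run of removed columns, the curve emerges at the next kept column, in the same row
and direction, and stays in removed columns in between. -/
theorem exists_curve_iterate_cross_gap {ω η : Om} {t n : ℤ} {c : ℤˣ} (ht : t ∈ Kset ω)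
    (hn : n ∈ Kset η) (d : ℕ) (x : ℤ) (hxt : x + c * d = t)
    (hgap : ∀ e : ℕ, e < d → x + c * e ∉ Kset ω) (hx : ¬(ω (x - c) = -c ∧ ω x = c)) :
    ∃ k : ℕ, (∀ j < k, ((curve (fun q => ω q.1 * η q.2))^[j] ((x, n), (↑c, 0))).1.1 ∉ Kset ω) ∧
      (curve (fun q => ω q.1 * η q.2))^[k] ((x, n), (↑c, 0)) = ((t, n), (↑c, 0)) := by
  induction d using Nat.strong_induction_on generalizing x with
  | _ d ih =>
  match d with
  | 0 => exact ⟨0, by simp, by simpa using hxt⟩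
  | 1 =>
    have h0 := hgap 0 one_pos
    simp only [Nat.cast_zero, mul_zero, add_zero, Nat.cast_one, mul_one] at h0 hxt
    have hp : ω x = -c ∧ ω (x + c) = c := by
      rw [mem_Kset_iff ω x c] at h0
      tauto
    rw [mem_Kset_iff ω t c, ← hxt, add_sub_cancel_right] at ht
    exact absurd hp ht.2
  | d + 2 =>
    have h0 := hgap 0 (by omega)
    have h1 := hgap 1 (by omega)
    simp only [Nat.cast_zero, mul_zero, add_zero, Nat.cast_one, mul_one] at h0 h1
    have hp : ω x = -c ∧ ω (x + c) = c := by
      rw [mem_Kset_iff ω x c] at h0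
      tauto
    obtain ⟨k, hk, hk'⟩ := ih d (by omega) (x + c + c) (by rw [← hxt]; push_cast; ring)
      (fun e he => by
        have hshift : x + c + c + c * (e : ℤ) = x + c * ((e + 2 : ℕ) : ℤ) := by
          push_cast
          ring
        rw [hshift]
        exact hgap (e + 2) (by omega))
      (by
        rw [add_sub_cancel_right, hp.2]
        intro h
        exact units_ne_neg_self c h.1)
    obtain ⟨e1, e2, e3, e4⟩ := curve_iterate_cross_pair hp.1 hp.2 hn
    refine ⟨k + 4, fun j hj => ?_, ?_⟩
    · match j with
      | 0 => exact h0
      | 1 => rw [e1]; exact h0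
      | 2 => rw [e2]; exact h1
      | 3 => rw [e3]; exact h1
      | j + 4 =>
        rw [Function.iterate_add_apply, e4]
        exact hk j (by omega)
    · rw [Function.iterate_add_apply, e4, hk']

/-- Consecutive kept indices are joined by a run of removed indices. -/
theorem exists_gap_between_consecutive {ω : Om} {κ : ℤ → ℤ} (hκ : StrictMono κ)
    (hκr : Set.range κ = Kset ω) (i : ℤ) (c : ℤˣ) :
    ∃ d : ℕ, κ i + c + c * d = κ (i + c) ∧ ∀ e : ℕ, e < d → κ i + c + c * e ∉ Kset ω := by
  rcases Int.units_eq_one_or c with rfl | rfl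
  · have hlt : κ i < κ (i + 1) := hκ (by omega)
    refine ⟨(κ (i + 1) - κ i - 1).toNat, by simp only [Units.val_one]; omega, fun e he => ?_⟩
    rw [← hκr]
    rintro ⟨l, hl⟩
    simp only [Units.val_one, one_mul] at hl
    have h1 : i < l := hκ.lt_iff_lt.1 (by omega)
    have h2 : l < i + 1 := hκ.lt_iff_lt.1 (by omega)
    omega
  · have hlt : κ (i + -1) < κ i := hκ (by omega)
    refine ⟨(κ i - κ (i + -1) - 1).toNat, by
      simp only [Units.val_neg, Units.val_one]; omega, fun e he => ?_⟩
    rw [← hκr]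
    rintro ⟨l, hl⟩
    simp only [Units.val_neg, Units.val_one] at hl
    have h1 : l < i := hκ.lt_iff_lt.1 (by omega)
    have h2 : i + -1 < l := hκ.lt_iff_lt.1 (by omega)
    omega

/-- The first return to the kept lattice when the first step is horizontal. -/
theorem exists_first_return_horizontal {ω η : Om} {κ₁ κ₂ : ℤ → ℤ} (hκ₁ : StrictMono κ₁)
    (hκ₁r : Set.range κ₁ = Kset ω) (hκ₂r : Set.range κ₂ = Kset η) (m n : ℤ) (b : ℤˣ) :
    ∃ k : ℕ, 1 ≤ k ∧
      (∀ j : ℕ, 1 ≤ j → j < k →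
        ((curve (fun q => ω q.1 * η q.2))^[j] ((κ₁ m, κ₂ n), (0, ↑b))).1.1 ∉ Kset ω) ∧
      (curve (fun q => ω q.1 * η q.2))^[k] ((κ₁ m, κ₂ n), (0, ↑b)) =
        ((κ₁ (m + ↑(ω (κ₁ m) * η (κ₂ n) * b)), κ₂ n), (↑(ω (κ₁ m) * η (κ₂ n) * b), 0)) := by
  set c : ℤˣ := ω (κ₁ m) * η (κ₂ n) * b with hc
  have hm : ∀ l, κ₁ l ∈ Kset ω := fun l => hκ₁r ▸ Set.mem_range_self l
  have hn : κ₂ n ∈ Kset η := hκ₂r ▸ Set.mem_range_self n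
  obtain ⟨d, hd, hgap⟩ := exists_gap_between_consecutive hκ₁ hκ₁r m c
  obtain ⟨k, hk, hk'⟩ := exists_curve_iterate_cross_gap (hm (m + c)) hn d _ hd hgap
    (by rw [add_sub_cancel_right]; exact ((mem_Kset_iff ω _ c).1 (hm m)).1)
  have hfirst : curve (fun q => ω q.1 * η q.2) ((κ₁ m, κ₂ n), (0, ↑b)) =
      ((κ₁ m + c, κ₂ n), (↑c, 0)) := by
    simp [curve, hc]
  refine ⟨k + 1, by omega, fun j hj hjk => ?_, ?_⟩
  · obtain ⟨j, rfl⟩ := Nat.exists_eq_add_of_le' hj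
    rw [Function.iterate_succ_apply, hfirst]
    exact hk j (by omega)
  · rw [Function.iterate_succ_apply, hfirst, hk']

/-- Exchanging the coordinates conjugates the curve following maps of `τ_{η,ω}` and
`τ_{ω,η}`. -/
theorem curve_semiconj_swap (ω η : Om) :
    Function.Semiconj (Prod.map Prod.swap Prod.swap)
      (curve (fun q => η q.1 * ω q.2)) (curve (fun q => ω q.1 * η q.2)) := by
  rintro ⟨⟨m, n⟩, a, b⟩
  simp [curve, mul_comm (ω n)]

/-- The first return to the kept lattice when the first step is vertical. -/
theorem exists_first_return_vertical {ω η : Om} {κ₁ κ₂ : ℤ → ℤ} (hκ₂ : StrictMono κ₂)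
    (hκ₁r : Set.range κ₁ = Kset ω) (hκ₂r : Set.range κ₂ = Kset η) (m n : ℤ) (a : ℤˣ) :
    ∃ k : ℕ, 1 ≤ k ∧
      (∀ j : ℕ, 1 ≤ j → j < k →
        ((curve (fun q => ω q.1 * η q.2))^[j] ((κ₁ m, κ₂ n), (↑a, 0))).1.2 ∉ Kset η) ∧
      (curve (fun q => ω q.1 * η q.2))^[k] ((κ₁ m, κ₂ n), (↑a, 0)) =
        ((κ₁ m, κ₂ (n + ↑(ω (κ₁ m) * η (κ₂ n) * a))), (0, ↑(ω (κ₁ m) * η (κ₂ n) * a))) := by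
  obtain ⟨k, hk1, hk, hk'⟩ := exists_first_return_horizontal hκ₂ hκ₂r hκ₁r n m a
  have hswap : ∀ j, (curve (fun q => ω q.1 * η q.2))^[j] ((κ₁ m, κ₂ n), (↑a, 0)) =
      Prod.map Prod.swap Prod.swap
        ((curve (fun q => η q.1 * ω q.2))^[j] ((κ₂ n, κ₁ m), (0, ↑a))) := fun j =>
    (((curve_semiconj_swap ω η).iterate_right j).eq ((κ₂ n, κ₁ m), (0, ↑a))).symm
  refine ⟨k, hk1, fun j hj hjk => ?_, ?_⟩
  · rw [hswap]
    exact hk j hj hjk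
  · rw [hswap, hk', mul_comm (η (κ₂ n))]
    rfl

theorem units_horizontal_mem_Nset (c : ℤˣ) : ((c : ℤ), (0 : ℤ)) ∈ Nset := by
  rcases Int.units_eq_one_or c with rfl | rfl <;> simp [Nset]

theorem units_vertical_mem_Nset (c : ℤˣ) : ((0 : ℤ), (c : ℤ)) ∈ Nset := by
  rcases Int.units_eq_one_or c with rfl | rfl <;> simp [Nset]

theorem exists_units_of_mem_Nset {v : ℤ × ℤ} (hv : v ∈ Nset) :
    (∃ a : ℤˣ, v = (↑a, 0)) ∨ ∃ b : ℤˣ, v = (0, ↑b) := by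
  rcases hv with rfl | rfl | rfl | rfl
  · exact Or.inl ⟨1, rfl⟩
  · exact Or.inl ⟨-1, rfl⟩
  · exact Or.inr ⟨1, rfl⟩
  · exact Or.inr ⟨-1, rfl⟩

/-- Tiling renormalization, Theorem 4.2 (1)–(2). Suppose `K(ω)` and
`K(η)` are unbounded above and below, `κ₁ : ℤ → K(ω)` and `κ₂ : ℤ → K(η)` are increasing
bijections, `K̄ = K(ω) × K(η)`, `τ = τ_{ω,η}` and `τ' = τ ∘ κ`. Then (1) every point of
`K̄ × N` returns to `K̄ × N` under positive iteration of the curve following map `𝒞` of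
`τ`, so the first return map `𝒞̂` is defined on all of `K̄ × N`; and (2) `𝒞̂ ∘ κ̃ = κ̃ ∘ 𝒞'`
where `κ̃((m,n),v) = (κ(m,n),v)` and `𝒞'` is the curve following map of `τ'`. -/
theorem tiling_renormalization (ω η : Om)
    (hω : ¬BddAbove (Kset ω) ∧ ¬BddBelow (Kset ω))
    (hη : ¬BddAbove (Kset η) ∧ ¬BddBelow (Kset η))
    (κ₁ κ₂ : ℤ → ℤ) (hκ₁ : StrictMono κ₁) (hκ₁r : Set.range κ₁ = Kset ω)
    (hκ₂ : StrictMono κ₂) (hκ₂r : Set.range κ₂ = Kset η) :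
    (∀ p : (ℤ × ℤ) × (ℤ × ℤ), p.1.1 ∈ Kset ω → p.1.2 ∈ Kset η → p.2 ∈ Nset →
      ∃ k : ℕ, 1 ≤ k ∧
        ((curve (fun q => ω q.1 * η q.2))^[k] p).1.1 ∈ Kset ω ∧
        ((curve (fun q => ω q.1 * η q.2))^[k] p).1.2 ∈ Kset η ∧
        ((curve (fun q => ω q.1 * η q.2))^[k] p).2 ∈ Nset) ∧
    (∀ p : (ℤ × ℤ) × (ℤ × ℤ), p.2 ∈ Nset →
      ∃ k : ℕ, 1 ≤ k ∧
        (((curve (fun q => ω q.1 * η q.2))^[k] ((κ₁ p.1.1, κ₂ p.1.2), p.2)).1.1 ∈ Kset ω ∧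
         ((curve (fun q => ω q.1 * η q.2))^[k] ((κ₁ p.1.1, κ₂ p.1.2), p.2)).1.2 ∈ Kset η ∧
         ((curve (fun q => ω q.1 * η q.2))^[k] ((κ₁ p.1.1, κ₂ p.1.2), p.2)).2 ∈ Nset) ∧
        (∀ j : ℕ, 1 ≤ j → j < k →
          ¬(((curve (fun q => ω q.1 * η q.2))^[j] ((κ₁ p.1.1, κ₂ p.1.2), p.2)).1.1 ∈ Kset ω ∧
            ((curve (fun q => ω q.1 * η q.2))^[j] ((κ₁ p.1.1, κ₂ p.1.2), p.2)).1.2 ∈ Kset η ∧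
            ((curve (fun q => ω q.1 * η q.2))^[j] ((κ₁ p.1.1, κ₂ p.1.2), p.2)).2 ∈ Nset)) ∧
        (curve (fun q => ω q.1 * η q.2))^[k] ((κ₁ p.1.1, κ₂ p.1.2), p.2) =
          ((κ₁ ((curve (fun q => ω (κ₁ q.1) * η (κ₂ q.2)) p).1.1),
            κ₂ ((curve (fun q => ω (κ₁ q.1) * η (κ₂ q.2)) p).1.2)),
           (curve (fun q => ω (κ₁ q.1) * η (κ₂ q.2)) p).2)) := by
  have hm : ∀ l, κ₁ l ∈ Kset ω := fun l => hκ₁r ▸ Set.mem_range_self l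
  have hn : ∀ l, κ₂ l ∈ Kset η := fun l => hκ₂r ▸ Set.mem_range_self l
  refine (and_iff_right_of_imp ?_).2 ?_
  · intro hreturn
    rintro ⟨⟨m, n⟩, v⟩ hp₁ hp₂ hv
    rw [← hκ₁r] at hp₁
    rw [← hκ₂r] at hp₂
    obtain ⟨m, rfl⟩ := hp₁
    obtain ⟨n, rfl⟩ := hp₂
    obtain ⟨k, hk, hmem, -⟩ := hreturn ((m, n), v) hv
    exact ⟨k, hk, hmem⟩
  · rintro ⟨⟨m, n⟩, v⟩ hv
    rcases exists_units_of_mem_Nset hv with ⟨a, rfl⟩ | ⟨b, rfl⟩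
    · obtain ⟨k, hk1, hk, hk'⟩ := exists_first_return_vertical hκ₂ hκ₁r hκ₂r m n a
      refine ⟨k, hk1, ?_, fun j hj hjk h => hk j hj hjk h.2.1, ?_⟩
      · rw [hk']
        exact ⟨hm _, hn _, units_vertical_mem_Nset _⟩
      · rw [hk']
        simp [curve]
    · obtain ⟨k, hk1, hk, hk'⟩ := exists_first_return_horizontal hκ₁ hκ₁r hκ₂r m n b
      refine ⟨k, hk1, ?_, fun j hj hjk h => hk j hj hjk h.1, ?_⟩
      · rw [hk']
        exact ⟨hm _, hn _, units_horizontal_mem_Nset _⟩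
      · rw [hk']
        simp [curve]
end

section
/- Let ω, η ∈ Ω± be such that K(ω) and K(η) have neither upper nor lower bounds, let K̄ = K(ω)×K(η), and let 𝒞 be the curve following map of τ_{ω,η} (a bijection of ℤ²×N, so negative iterates 𝒞^k, k < 0, are defined). Then for every ((m,n),v) ∈ ℤ²×N the following are equivalent: (a) 𝒞^k((m,n),v) ∉ K̄×N for every k ≥ 1; (b) 𝒞^k((m,n),v) ∉ K̄×N for every k ≤ −1; (c) 𝒞⁴((m,n),v) = ((m,n),v). Moreover, if 𝒞^p((m,n),v) = ((m,n),v) for some p ≥ 1, then there exists k ≥ 1 such that the ℤ²-component of 𝒞^k((m,n),v) does not lie in K̄. -/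
/-- The curve following map of `τ : ℤ² → {1,−1}`, as a bijection of `ℤ² × ℤ²`:
`𝒞((m,n),(a,b)) = ((m+sb, n+sa), (sb,sa))` where `s = τ(m,n)`. -/
def curveEquiv (τ : ℤ × ℤ → ℤˣ) : Equiv.Perm ((ℤ × ℤ) × (ℤ × ℤ)) where
  toFun p := ((p.1.1 + (τ p.1 : ℤ) * p.2.2, p.1.2 + (τ p.1 : ℤ) * p.2.1),
    ((τ p.1 : ℤ) * p.2.2, (τ p.1 : ℤ) * p.2.1))
  invFun p := ((p.1.1 - p.2.1, p.1.2 - p.2.2),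
    ((τ (p.1.1 - p.2.1, p.1.2 - p.2.2) : ℤ) * p.2.2,
     (τ (p.1.1 - p.2.1, p.1.2 - p.2.2) : ℤ) * p.2.1))
  left_inv := by
    rintro ⟨⟨m, n⟩, a, b⟩
    have hs : ((τ (m, n) : ℤˣ) : ℤ) * ((τ (m, n) : ℤˣ) : ℤ) = 1 := by
      rw [← Units.val_mul, Int.units_mul_self, Units.val_one]
    simp only [add_sub_cancel_right]
    simp [← mul_assoc, hs]
  right_inv := by
    rintro ⟨⟨m, n⟩, a, b⟩
    have hs : ((τ (m - a, n - b) : ℤˣ) : ℤ) * ((τ (m - a, n - b) : ℤˣ) : ℤ) = 1 := by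
      rw [← Units.val_mul, Int.units_mul_self, Units.val_one]
    simp [← mul_assoc, hs, sub_add_cancel]

/-- Membership in `K̄ × N`, where `K̄ = K(ω) × K(η)`. -/
def inKN (ω η : Om) (p : (ℤ × ℤ) × (ℤ × ℤ)) : Prop :=
  p.1.1 ∈ Kset ω ∧ p.1.2 ∈ Kset η ∧ p.2 ∈ Nset

/-- The curve following map of `τ_{ω,η}`. -/
abbrev curveMap (ω η : Om) : Equiv.Perm ((ℤ × ℤ) × (ℤ × ℤ)) :=
  curveEquiv (fun q => ω q.1 * η q.2)

/-- `p` lies on a loop of length four, or its forward orbit (including `p`) meets `K̄ × N`. -/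
def LoopsOrReturns (ω η : Om) (p : (ℤ × ℤ) × (ℤ × ℤ)) : Prop :=
  (curveMap ω η)^[4] p = p ∨ ∃ k : ℕ, inKN ω η ((curveMap ω η)^[k] p)

/-- `Kset ω` is unbounded in both directions. -/
def BiUnbounded (ω : Om) : Prop :=
  (∀ x : ℤ, ∃ y ∈ Kset ω, x ≤ y) ∧ ∀ x : ℤ, ∃ y ∈ Kset ω, y ≤ x

/-- The reflection of a sign sequence that preserves the pattern `−1, 1`. -/
def reflect (ω : Om) : Om := fun m => -ω (-m)

section Symmetry

variable {ω η : Om}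

theorem curveMap_apply (ω η : Om) (m n a b : ℤ) :
    curveMap ω η ((m, n), (a, b)) =
      ((m + (ω m : ℤ) * (η n : ℤ) * b, n + (ω m : ℤ) * (η n : ℤ) * a),
        ((ω m : ℤ) * (η n : ℤ) * b, (ω m : ℤ) * (η n : ℤ) * a)) := by
  simp [curveEquiv]

theorem Nset_neg_fst {a b : ℤ} (h : (a, b) ∈ Nset) : (-a, b) ∈ Nset := by
  simp only [Nset, Set.mem_insert_iff, Set.mem_singleton_iff, Prod.mk.injEq] at *
  omega

theorem Nset_swap {a b : ℤ} (h : (a, b) ∈ Nset) : (b, a) ∈ Nset := by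
  simp only [Nset, Set.mem_insert_iff, Set.mem_singleton_iff, Prod.mk.injEq] at *
  omega

theorem Nset_neg {a b : ℤ} (h : (a, b) ∈ Nset) : (-a, -b) ∈ Nset := by
  simp only [Nset, Set.mem_insert_iff, Set.mem_singleton_iff, Prod.mk.injEq] at *
  omega

theorem Nset_curveMap {p : (ℤ × ℤ) × (ℤ × ℤ)} (h : p.2 ∈ Nset) :
    (curveMap ω η p).2 ∈ Nset := by
  obtain ⟨⟨m, n⟩, a, b⟩ := p
  rw [curveMap_apply]
  rcases Int.units_eq_one_or (ω m) with h1 | h1 <;>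
    rcases Int.units_eq_one_or (η n) with h2 | h2 <;>
    simp only [h1, h2, Units.val_one, Units.val_neg, one_mul, neg_mul, mul_neg, neg_neg] <;>
    first
    | exact Nset_swap h
    | exact Nset_neg (Nset_swap h)

theorem neg_mem_Kset_reflect {m : ℤ} : -m ∈ Kset (reflect ω) ↔ m ∈ Kset ω := by
  have h1 : -(-m + 1) = m - 1 := by ring
  have h2 : -(-m - 1) = m + 1 := by ring
  simp only [Kset, reflect, Set.mem_ofPred_eq, h1, h2, neg_neg, neg_inj]
  have h3 (u : ℤˣ) : -u = 1 ↔ u = -1 := neg_eq_iff_eq_neg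
  rw [h3, h3]
  tauto

theorem BiUnbounded.reflect (h : BiUnbounded ω) : BiUnbounded (reflect ω) := by
  refine ⟨fun x => ?_, fun x => ?_⟩
  · obtain ⟨y, hy, hyx⟩ := h.2 (-x)
    exact ⟨-y, neg_mem_Kset_reflect.2 hy, by omega⟩
  · obtain ⟨y, hy, hyx⟩ := h.1 (-x)
    exact ⟨-y, neg_mem_Kset_reflect.2 hy, by omega⟩

theorem LoopsOrReturns.transport {ω' η' : Om}
    {φ : (ℤ × ℤ) × (ℤ × ℤ) → (ℤ × ℤ) × (ℤ × ℤ)} (hφ : Function.Injective φ)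
    (hsemi : Function.Semiconj φ (curveMap ω η) (curveMap ω' η'))
    (hK : ∀ p, inKN ω' η' (φ p) → inKN ω η p) {p : (ℤ × ℤ) × (ℤ × ℤ)}
    (h : LoopsOrReturns ω' η' (φ p)) : LoopsOrReturns ω η p := by
  rcases h with h | ⟨k, h⟩
  · rw [← (hsemi.iterate_right 4).eq] at h
    exact Or.inl (hφ h)
  · rw [← (hsemi.iterate_right k).eq] at h
    exact Or.inr ⟨k, hK _ h⟩

theorem LoopsOrReturns.of_swap {m n a b : ℤ} (h : LoopsOrReturns η ω ((n, m), (b, a))) :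
    LoopsOrReturns ω η ((m, n), (a, b)) := by
  refine LoopsOrReturns.transport (φ := fun p => (p.1.swap, p.2.swap)) ?_ ?_ ?_ h
  · rintro ⟨⟨m, n⟩, a, b⟩ ⟨⟨m', n'⟩, a', b'⟩ h
    simp only [Prod.swap_prod_mk, Prod.mk.injEq] at h ⊢
    tauto
  · rintro ⟨⟨m, n⟩, a, b⟩
    simp only [curveMap_apply, Prod.swap_prod_mk, mul_comm (ω m : ℤ)]
  · rintro ⟨⟨m, n⟩, a, b⟩ ⟨h1, h2, h3⟩
    exact ⟨h2, h1, Nset_swap h3⟩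

theorem LoopsOrReturns.of_reflect {m n a b : ℤ}
    (h : LoopsOrReturns (reflect ω) η ((-m, n), (-a, b))) :
    LoopsOrReturns ω η ((m, n), (a, b)) := by
  refine LoopsOrReturns.transport
    (φ := fun p => ((-p.1.1, p.1.2), (-p.2.1, p.2.2))) ?_ ?_ ?_ h
  · rintro ⟨⟨m, n⟩, a, b⟩ ⟨⟨m', n'⟩, a', b'⟩ h
    simpa only [Prod.mk.injEq, neg_inj] using h
  · rintro ⟨⟨m, n⟩, a, b⟩
    simp only [curveMap_apply, reflect, neg_neg, Units.val_neg, Prod.mk.injEq]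
    refine ⟨⟨?_, ?_⟩, ?_, ?_⟩ <;> ring
  · rintro ⟨⟨m, n⟩, a, b⟩ ⟨h1, h2, h3⟩
    refine ⟨neg_mem_Kset_reflect.1 h1, h2, ?_⟩
    simpa using Nset_neg_fst h3

end Symmetry

section Following

variable {ω η : Om}

theorem loop_of_curveMap {p : (ℤ × ℤ) × (ℤ × ℤ)}
    (h : (curveMap ω η)^[4] (curveMap ω η p) = curveMap ω η p) :
    (curveMap ω η)^[4] p = p := by
  rw [← Function.iterate_succ_apply, Function.iterate_succ_apply'] at h
  exact (curveMap ω η).injective h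

theorem LoopsOrReturns.of_curveMap {p : (ℤ × ℤ) × (ℤ × ℤ)}
    (h : LoopsOrReturns ω η (curveMap ω η p)) : LoopsOrReturns ω η p := by
  rcases h with h | ⟨k, h⟩
  · exact Or.inl (loop_of_curveMap h)
  · exact Or.inr ⟨k + 1, h⟩

/-- One step of the curve, with the next position and direction given explicitly. -/
theorem LoopsOrReturns.step {m n a b : ℤ} (m' n' a' b' : ℤ)
    (h : LoopsOrReturns ω η ((m', n'), (a', b')))
    (ha : (ω m : ℤ) * (η n : ℤ) * b = a' ∧ (ω m : ℤ) * (η n : ℤ) * a = b')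
    (hm : m + a' = m' ∧ n + b' = n') :
    LoopsOrReturns ω η ((m, n), (a, b)) := by
  apply LoopsOrReturns.of_curveMap
  rw [curveMap_apply, ha.1, ha.2, hm.1, hm.2]
  exact h

theorem not_mem_Kset_iff {m : ℤ} :
    m ∉ Kset ω ↔ (ω m = -1 ∧ ω (m + 1) = 1) ∨ (ω (m - 1) = -1 ∧ ω m = 1) := by
  simp only [Kset, Set.mem_ofPred_eq]
  tauto

theorem curve_loops {m n : ℤ} {u : ℤˣ} (h1 : ω m = u) (h2 : ω (m + 1) = -u)
    (h3 : η n = -u) (h4 : η (n + 1) = u) :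
    (curveMap ω η)^[4] ((m, n), (0, -1)) = ((m, n), (0, -1)) ∧
    (curveMap ω η)^[4] ((m, n), (-1, 0)) = ((m, n), (-1, 0)) := by
  rcases Int.units_eq_one_or u with rfl | rfl <;>
    simp [Function.iterate_succ_apply, curveMap_apply, h1, h2, h3, h4]

/-- In a row of `Kset η`, a curve that enters the columns from the left crosses every deleted pair
of columns and so reaches `Kset ω`. -/
theorem returns_right {m n : ℤ} (hω : BiUnbounded ω) (hn : n ∈ Kset η)
    (hm : ¬(ω (m - 1) = -1 ∧ ω m = 1)) : LoopsOrReturns ω η ((m, n), (1, 0)) := by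
  obtain ⟨y, hy, hmy⟩ := hω.1 m
  obtain ⟨d, rfl⟩ := Int.exists_add_of_le hmy
  clear hmy
  induction d using Nat.strong_induction_on generalizing m with
  | _ d ih =>
  by_cases hmK : m ∈ Kset ω
  · exact Or.inr ⟨0, hmK, hn, by simp [Nset]⟩
  obtain ⟨h1, h2⟩ : ω m = -1 ∧ ω (m + 1) = 1 :=
    (not_mem_Kset_iff.1 hmK).resolve_right hm
  have hnext : LoopsOrReturns ω η ((m + 2, n), (1, 0)) := by
    match d, ih, hy with
    | 0, _, hy => exact absurd (by simpa using hy) hmK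
    | 1, _, hy =>
      refine absurd hy (not_mem_Kset_iff.2 (Or.inr ?_))
      simpa using ⟨h1, h2⟩
    | d + 2, ih, hy =>
      refine ih d (by omega) ?_ ?_
      · rw [show m + 2 - 1 = m + 1 by ring, h2]
        simp
      · convert hy using 1
        push_cast
        ring
  rcases Int.units_eq_one_or (η n) with h3 | h3
  · have h4 : η (n - 1) = 1 :=
      (Int.units_eq_one_or _).resolve_right fun h => hn.2 ⟨h, h3⟩
    refine .step m (n - 1) 0 (-1) (.step (m + 1) (n - 1) 1 0 (.step (m + 1) n 0 1
      (.step (m + 2) n 1 0 hnext ?_ ?_) ?_ ?_) ?_ ?_) ?_ ?_ <;>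
      first | omega | simp [h1, h2, h3, h4]
  · have h4 : η (n + 1) = -1 :=
      (Int.units_eq_one_or _).resolve_left fun h => hn.1 ⟨h3, h⟩
    refine .step m (n + 1) 0 1 (.step (m + 1) (n + 1) 1 0 (.step (m + 1) n 0 (-1)
      (.step (m + 2) n 1 0 hnext ?_ ?_) ?_ ?_) ?_ ?_) ?_ ?_ <;>
      first | omega | simp [h1, h2, h3, h4]

theorem returns_left {m n : ℤ} (hω : BiUnbounded ω) (hn : n ∈ Kset η)
    (hm : ¬(ω m = -1 ∧ ω (m + 1) = 1)) : LoopsOrReturns ω η ((m, n), (-1, 0)) := by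
  refine .of_reflect ?_
  rw [neg_neg]
  refine returns_right hω.reflect hn ?_
  simp only [reflect, neg_neg, show -(-m - 1) = m + 1 by ring, neg_eq_iff_eq_neg]
  tauto

/-- A curve leaving a deleted pair of columns to the left. -/
theorem exit_left {m : ℤ} (n : ℤ) (hω : BiUnbounded ω) (hη : BiUnbounded η)
    (h1 : ω m = -1) : LoopsOrReturns ω η ((m - 1, n), (-1, 0)) := by
  have hm : m - 1 + 1 = m := by ring
  by_cases hn : n ∈ Kset η
  · refine returns_left hω hn ?_
    simp [hm, h1]
  rcases Int.units_eq_one_or (ω (m - 1)) with h2 | h2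
  · rcases not_mem_Kset_iff.1 hn with ⟨h3, h4⟩ | ⟨h3, h4⟩
    · exact Or.inl (curve_loops (u := 1) h2 (by rw [hm, h1]) h3 h4).2
    · refine .step (m - 1) (n - 1) 0 (-1) (Or.inl (curve_loops (u := 1) h2 (by rw [hm, h1]) h3
        (by simpa using h4)).1) ?_ ?_ <;>
        first | omega | simp [h2, h4]
  · have hmK : m - 1 ∈ Kset ω := by
      simp [Kset, hm, h1, h2]
    rcases not_mem_Kset_iff.1 hn with ⟨h3, h4⟩ | ⟨h3, h4⟩
    · refine .step (m - 1) (n - 1) 0 (-1) (.of_swap (returns_left hη hmK ?_)) ?_ ?_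
      · simp [h3]
      · simp [h2, h3]
      · omega
    · refine .step (m - 1) (n + 1) 0 1 (.of_swap (returns_right hη hmK ?_)) ?_ ?_
      · simp [h4]
      · simp [h2, h4]
      · omega

theorem exit_right {m : ℤ} (n : ℤ) (hω : BiUnbounded ω) (hη : BiUnbounded η)
    (h1 : ω m = 1) : LoopsOrReturns ω η ((m + 1, n), (1, 0)) := by
  refine .of_reflect ?_
  rw [show -(m + 1) = -m - 1 by ring]
  exact exit_left n hω.reflect hη (by simp [reflect, h1])

theorem loopsOrReturns_left_column {m n : ℤ} {v : ℤ × ℤ} (hω : BiUnbounded ω)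
    (hη : BiUnbounded η) (h1 : ω m = -1) (h2 : ω (m + 1) = 1) (hv : v ∈ Nset) :
    LoopsOrReturns ω η ((m, n), v) := by
  have exitL (k : ℤ) := exit_left k hω hη h1
  have exitR (k : ℤ) := exit_right k hω hη h2
  have loop {k : ℤ} (h3 : η k = 1) (h4 : η (k + 1) = -1) :=
    curve_loops (u := -1) h1 (by simpa using h2) (by simpa using h3) h4
  have loopU {k : ℤ} (h3 : η k = 1) (h4 : η (k + 1) = -1) :
      LoopsOrReturns ω η ((m, k), (0, -1)) := Or.inl (loop h3 h4).1
  have loopL {k : ℤ} (h3 : η k = 1) (h4 : η (k + 1) = -1) :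
      LoopsOrReturns ω η ((m, k), (-1, 0)) := Or.inl (loop h3 h4).2
  have up {k : ℤ} (h : η k = 1) : LoopsOrReturns ω η ((m, k), (0, 1)) :=
    .step _ _ _ _ (exitL k) (by simp [h1, h]) (by omega)
  have down {k : ℤ} (h : η k = -1) : LoopsOrReturns ω η ((m, k), (0, -1)) :=
    .step _ _ _ _ (exitL k) (by simp [h1, h]) (by omega)
  have up' {k : ℤ} (h : η k = 1) : LoopsOrReturns ω η ((m + 1, k), (0, 1)) :=
    .step _ _ _ _ (exitR k) (by simp [h2, h]) (by omega)
  have down' {k : ℤ} (h : η k = -1) : LoopsOrReturns ω η ((m + 1, k), (0, -1)) :=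
    .step _ _ _ _ (exitR k) (by simp [h2, h]) (by omega)
  have right_up {k : ℤ} (h : η k = 1) : LoopsOrReturns ω η ((m, k), (0, -1)) := by
    rcases Int.units_eq_one_or (η (k + 1)) with h' | h'
    · refine .step (m + 1) k 1 0 (.step (m + 1) (k + 1) 0 1 (up' h') ?_ ?_) ?_ ?_ <;>
        simp [h1, h2, h]
    · exact loopU h h'
  have right_down {k : ℤ} (h : η k = -1) : LoopsOrReturns ω η ((m, k), (0, 1)) := by
    rcases Int.units_eq_one_or (η (k - 1)) with h' | h'
    · refine .step (m + 1) k 1 0 (.step (m + 1) (k - 1) 0 (-1) (.step m (k - 1) (-1) 0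
        (loopL h' (by simpa using h)) ?_ ?_) ?_ ?_) ?_ ?_ <;>
        first | omega | simp [h1, h2, h, h']
    · refine .step (m + 1) k 1 0 (.step (m + 1) (k - 1) 0 (-1) (down' h') ?_ ?_) ?_ ?_ <;>
        first | omega | simp [h1, h2, h]
  have vert (k b : ℤ) (hb : b = 1 ∨ b = -1) : LoopsOrReturns ω η ((m, k), (0, b)) := by
    rcases Int.units_eq_one_or (η k) with h | h <;> rcases hb with rfl | rfl
    · exact up h
    · exact right_up h
    · exact right_down h
    · exact down h
  simp only [Nset, Set.mem_insert_iff, Set.mem_singleton_iff] at hv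
  rcases hv with rfl | rfl | rfl | rfl
  · refine .step _ _ _ _ (vert _ ((ω m : ℤ) * (η n : ℤ)) ?_) ⟨mul_zero _, mul_one _⟩
      ⟨add_zero _, rfl⟩
    rcases Int.units_eq_one_or (η n) with h | h <;> simp [h1, h]
  · refine .step _ _ _ _ (vert _ (-((ω m : ℤ) * (η n : ℤ))) ?_) ⟨mul_zero _, mul_neg_one _⟩
      ⟨add_zero _, rfl⟩
    rcases Int.units_eq_one_or (η n) with h | h <;> simp [h1, h]
  · exact vert n 1 (Or.inl rfl)
  · exact vert n (-1) (Or.inr rfl)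

theorem loopsOrReturns_of_column {m n : ℤ} {v : ℤ × ℤ} (hω : BiUnbounded ω)
    (hη : BiUnbounded η) (hm : m ∉ Kset ω) (hv : v ∈ Nset) :
    LoopsOrReturns ω η ((m, n), v) := by
  rcases not_mem_Kset_iff.1 hm with ⟨h1, h2⟩ | ⟨h1, h2⟩
  · exact loopsOrReturns_left_column hω hη h1 h2 hv
  · refine .of_reflect (loopsOrReturns_left_column hω.reflect hη ?_ ?_ (Nset_neg_fst hv))
    · simp [reflect, h2]
    · simp [reflect, show -(-m + 1) = m - 1 by ring, h1]

theorem loopsOrReturns {p : (ℤ × ℤ) × (ℤ × ℤ)} (hω : BiUnbounded ω) (hη : BiUnbounded η)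
    (hp : p.2 ∈ Nset) : LoopsOrReturns ω η p := by
  obtain ⟨⟨m, n⟩, a, b⟩ := p
  by_cases hm : m ∈ Kset ω
  · by_cases hn : n ∈ Kset η
    · exact Or.inr ⟨0, hm, hn, hp⟩
    · exact .of_swap (loopsOrReturns_of_column hη hω hn (Nset_swap hp))
  · exact loopsOrReturns_of_column hω hη hm hp

theorem not_inKN_of_loop {p : (ℤ × ℤ) × (ℤ × ℤ)} (h : (curveMap ω η)^[4] p = p) :
    ¬ inKN ω η p := by
  obtain ⟨⟨m, n⟩, v⟩ := p
  rintro ⟨hm, hn, hv⟩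
  simp only [Nset, Set.mem_insert_iff, Set.mem_singleton_iff] at hv
  simp only [Kset, Set.mem_ofPred_eq] at hm hn
  rcases hv with rfl | rfl | rfl | rfl <;>
    rcases Int.units_eq_one_or (ω m) with h1 | h1 <;>
    rcases Int.units_eq_one_or (η n) with h2 | h2 <;>
    simp only [Function.iterate_succ_apply, Function.iterate_zero_apply, curveMap_apply, h1, h2,
      Units.val_one, Units.val_neg, one_mul, mul_one, mul_zero, add_zero, neg_mul, mul_neg,
      neg_neg, ← sub_eq_add_neg, Prod.mk.injEq] at h <;>
    rcases Int.units_eq_one_or (η (n + 1)) with h3 | h3 <;>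
    rcases Int.units_eq_one_or (η (n - 1)) with h4 | h4 <;>
    rcases Int.units_eq_one_or (ω (m + 1)) with h5 | h5 <;>
    rcases Int.units_eq_one_or (ω (m - 1)) with h6 | h6 <;>
    simp_all [← sub_eq_add_neg] <;> omega

theorem forward_iff_loop {p : (ℤ × ℤ) × (ℤ × ℤ)} (hω : BiUnbounded ω) (hη : BiUnbounded η)
    (hp : p.2 ∈ Nset) :
    (∀ k : ℕ, 1 ≤ k → ¬ inKN ω η ((curveMap ω η)^[k] p)) ↔ (curveMap ω η)^[4] p = p := by
  refine ⟨fun h => ?_, fun h k _ => not_inKN_of_loop ?_⟩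
  · rcases loopsOrReturns hω hη (Nset_curveMap (ω := ω) (η := η) hp) with h' | ⟨k, h'⟩
    · exact loop_of_curveMap h'
    · exact absurd h' (h (k + 1) (by omega))
  · rw [← Function.iterate_add_apply, add_comm, Function.iterate_add_apply, h]

end Following

section Reversal

variable {ω η : Om}

/-- The other orientation of the arc of the tile at `p.1` that is entered with direction `p.2`. -/
def reverse (ω η : Om) (p : (ℤ × ℤ) × (ℤ × ℤ)) : (ℤ × ℤ) × (ℤ × ℤ) :=
  (p.1, (-((ω p.1.1 : ℤ) * (η p.1.2 : ℤ) * p.2.2), -((ω p.1.1 : ℤ) * (η p.1.2 : ℤ) * p.2.1)))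

theorem reverse_reverse (p : (ℤ × ℤ) × (ℤ × ℤ)) : reverse ω η (reverse ω η p) = p := by
  obtain ⟨⟨m, n⟩, a, b⟩ := p
  rcases Int.units_eq_one_or (ω m) with h1 | h1 <;>
    rcases Int.units_eq_one_or (η n) with h2 | h2 <;> simp [reverse, h1, h2]

theorem curveMap_reverse_curveMap (p : (ℤ × ℤ) × (ℤ × ℤ)) :
    curveMap ω η (reverse ω η (curveMap ω η p)) = reverse ω η p := by
  obtain ⟨⟨m, n⟩, a, b⟩ := p
  simp only [reverse, curveMap_apply]
  generalize (ω m : ℤ) * (η n : ℤ) * a = c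
  generalize (ω m : ℤ) * (η n : ℤ) * b = d
  rcases Int.units_eq_one_or (ω (m + d)) with h1 | h1 <;>
    rcases Int.units_eq_one_or (η (n + c)) with h2 | h2 <;> simp [h1, h2]

theorem iterate_reverse_iterate (k : ℕ) (p : (ℤ × ℤ) × (ℤ × ℤ)) :
    (curveMap ω η)^[k] (reverse ω η ((curveMap ω η)^[k] p)) = reverse ω η p := by
  induction k generalizing p with
  | zero => rfl
  | succ k ih =>
    rw [Function.iterate_succ_apply (curveMap ω η) k p, Function.iterate_succ_apply', ih,
      curveMap_reverse_curveMap]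

theorem zpow_neg_eq_reverse (k : ℕ) (p : (ℤ × ℤ) × (ℤ × ℤ)) :
    (curveMap ω η ^ (-(k : ℤ))) p = reverse ω η ((curveMap ω η)^[k] (reverse ω η p)) := by
  rw [zpow_neg, zpow_natCast, Equiv.Perm.inv_eq_iff_eq, ← Equiv.Perm.iterate_eq_pow,
    iterate_reverse_iterate, reverse_reverse]

theorem loop_reverse {p : (ℤ × ℤ) × (ℤ × ℤ)} (h : (curveMap ω η)^[4] p = p) :
    (curveMap ω η)^[4] (reverse ω η p) = reverse ω η p := by
  conv_lhs => rw [← h]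
  exact iterate_reverse_iterate 4 p

theorem Nset_reverse {p : (ℤ × ℤ) × (ℤ × ℤ)} (h : p.2 ∈ Nset) : (reverse ω η p).2 ∈ Nset :=
  Nset_neg (Nset_curveMap (ω := ω) (η := η) h)

theorem inKN.reverse {p : (ℤ × ℤ) × (ℤ × ℤ)} (h : inKN ω η p) : inKN ω η (reverse ω η p) :=
  ⟨h.1, h.2.1, Nset_reverse h.2.2⟩

theorem backward_iff_loop {p : (ℤ × ℤ) × (ℤ × ℤ)} (hω : BiUnbounded ω) (hη : BiUnbounded η)
    (hp : p.2 ∈ Nset) :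
    (∀ k : ℕ, 1 ≤ k → ¬ inKN ω η ((curveMap ω η ^ (-(k : ℤ))) p)) ↔
      (curveMap ω η)^[4] p = p := by
  have key := forward_iff_loop hω hη (Nset_reverse (ω := ω) (η := η) hp)
  simp only [zpow_neg_eq_reverse]
  refine ⟨fun h => ?_, fun h k hk hin => ?_⟩
  · have := loop_reverse (key.1 fun k hk hin => h k hk hin.reverse)
    rwa [reverse_reverse] at this
  · have := hin.reverse
    rw [reverse_reverse] at this
    exact key.2 (loop_reverse h) k hk this

end Reversal

section Periodic

variable {ω η : Om}

/-- If an orbit stays in the columns of `Kset ω`, then `η` takes the value `1` at its top row and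
`−1` at its bottom row. -/
theorem sign_of_extreme_row {Q : ℤ → (ℤ × ℤ) × (ℤ × ℤ)}
    (hQ : ∀ k, Q (k + 1) = curveMap ω η (Q k)) (hN : ∀ k, (Q k).2 ∈ Nset)
    (hK : ∀ k, (Q k).1.1 ∈ Kset ω) (e : ℤˣ) {r : ℤ}
    (hmax : ∀ k, (e : ℤ) * (Q k).1.2 ≤ e * r) (hr : ∃ k, (Q k).1.2 = r) : η r = e := by
  have vertical (k : ℤ) (hk : (Q k).1.2 = r) (ha : (Q k).2.1 = 0) : η r = e := by
    have hprev : (Q (k - 1)).1.2 = (Q k).1.2 - (Q k).2.2 := by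
      have := hQ (k - 1)
      rw [sub_add_cancel] at this
      rw [this]
      simp [curveEquiv]
    have hb : (Q k).2.2 = e := by
      have h1 := hmax (k - 1)
      have h2 := hN k
      rw [hprev, hk] at h1
      generalize (Q k).2 = v at h1 h2 ha
      obtain ⟨a, b⟩ := v
      simp only [Nset, Set.mem_insert_iff, Set.mem_singleton_iff, Prod.mk.injEq] at h2
      rcases Int.units_eq_one_or e with rfl | rfl <;> simp at h1 ha ⊢ <;> omega
    have h1 := hQ k
    have h2 := hQ (k + 1)
    have h3 := hmax (k + 1 + 1)
    have hm := hK k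
    generalize Q k = q at *
    obtain ⟨⟨m, n⟩, a, b⟩ := q
    dsimp only at hk ha hb hm
    subst hk ha hb
    rw [curveMap_apply] at h1
    rw [h1, curveMap_apply] at h2
    rw [h2] at h3
    simp only [Kset, Set.mem_ofPred_eq] at hm
    rcases Int.units_eq_one_or e with rfl | rfl <;>
      rcases Int.units_eq_one_or (ω m) with h4 | h4 <;>
      rcases Int.units_eq_one_or (η n) with h5 | h5 <;>
      rcases Int.units_eq_one_or (ω (m + 1)) with h6 | h6 <;>
      rcases Int.units_eq_one_or (ω (m - 1)) with h7 | h7 <;>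
      simp_all [← sub_eq_add_neg]
  obtain ⟨k, hk⟩ := hr
  by_cases ha : (Q k).2.1 = 0
  · exact vertical k hk ha
  · have hstep := hQ (k - 1)
    rw [sub_add_cancel] at hstep
    have hb : (Q k).2.2 = 0 := by
      have := hN k
      generalize (Q k).2 = v at this ha
      obtain ⟨a, b⟩ := v
      simp only [Nset, Set.mem_insert_iff, Set.mem_singleton_iff, Prod.mk.injEq] at this
      dsimp only at ha ⊢
      omega
    rw [hstep] at hb hk
    generalize hq : Q (k - 1) = q at *
    obtain ⟨⟨m, n⟩, a, b⟩ := q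
    rw [curveMap_apply] at hb hk
    have ha' : a = 0 := by simpa using hb
    exact vertical (k - 1) (by simpa [hq, ha'] using hk) (by simpa [hq] using ha')

theorem exists_ascent {s t : ℤ} (hst : s ≤ t) (hs : η s = -1) (ht : η t = 1) :
    ∃ n, s ≤ n ∧ n < t ∧ η n = -1 ∧ η (n + 1) = 1 := by
  by_contra! hne
  have h (n : ℤ) (hn : s ≤ n) : n ≤ t → η n = -1 := by
    induction n, hn using Int.leInduction with
    | base => exact fun _ => hs
    | succ n hn ih =>
      intro hnt
      exact (Int.units_eq_one_or _).resolve_left (hne n hn (by omega) (ih (by omega)))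
  have := h t hst le_rfl
  rw [ht] at this
  exact absurd this (by decide)

theorem exists_max_of_periodic {y : ℤ → ℤ} {j : ℤ} (hj : 0 < j) (hy : Function.Periodic y j) :
    ∃ i, ∀ k, y k ≤ y i := by
  obtain ⟨i, -, hi⟩ := Finset.exists_max_image (Finset.Ico 0 j) y ⟨0, by simpa using hj⟩
  refine ⟨i, fun k => ?_⟩
  have h : y (k % j) = y k := by
    rw [Int.emod_def, mul_comm]
    exact hy.sub_int_mul_eq _
  rw [← h]
  exact hi _ (Finset.mem_Ico.2 ⟨Int.emod_nonneg _ hj.ne', Int.emod_lt_of_pos _ hj⟩)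

/-- No periodic orbit stays in `K̄`. -/
theorem false_of_orbit_in_Kset {Q : ℤ → (ℤ × ℤ) × (ℤ × ℤ)} {j : ℤ} (hj : 0 < j)
    (hper : Function.Periodic Q j) (hQ : ∀ k, Q (k + 1) = curveMap ω η (Q k))
    (hN : ∀ k, (Q k).2 ∈ Nset) (hω : ∀ k, (Q k).1.1 ∈ Kset ω)
    (hη : ∀ k, (Q k).1.2 ∈ Kset η) : False := by
  obtain ⟨i, hi⟩ := exists_max_of_periodic (y := fun k => (Q k).1.2) hj
    fun k => by simp only [hper k]
  obtain ⟨l, hl⟩ := exists_max_of_periodic (y := fun k => -(Q k).1.2) hj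
    fun k => by simp only [hper k]
  have htop := sign_of_extreme_row hQ hN hω 1 (by simpa using hi) ⟨i, rfl⟩
  have hbot := sign_of_extreme_row hQ hN hω (-1) (by simpa using hl) ⟨l, rfl⟩
  obtain ⟨n, hln, hni, h1, h2⟩ := exists_ascent (hi l) hbot htop
  have hside (k : ℤ) : n < (Q k).1.2 ↔ n < (Q (k + 1)).1.2 := by
    have ne (k : ℤ) : (Q k).1.2 ≠ n ∧ (Q k).1.2 ≠ n + 1 := by
      refine ⟨fun h => ?_, fun h => ?_⟩ <;> have := hη k <;> rw [h] at this
      · exact this.1 ⟨h1, h2⟩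
      · exact this.2 ⟨by simpa using h1, h2⟩
    have hstep : (Q (k + 1)).1.2 = (Q k).1.2 + (Q (k + 1)).2.2 := by
      rw [hQ]
      simp [curveEquiv]
    have hv := hN (k + 1)
    have h3 := ne k
    have h4 := ne (k + 1)
    simp only [Nset, Set.mem_insert_iff, Set.mem_singleton_iff, Prod.ext_iff] at hv
    omega
  have hall (k : ℤ) : n < (Q k).1.2 ↔ n < (Q 0).1.2 := by
    induction k using Int.induction_on with
    | zero => rfl
    | succ k ih => rw [← hside, ih]
    | pred k ih => rw [hside, sub_add_cancel, ih]
  have := (hall l).2 ((hall i).1 hni)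
  omega

theorem exists_not_mem_of_periodic {p : (ℤ × ℤ) × (ℤ × ℤ)} (hp : p.2 ∈ Nset) {j : ℤ}
    (hj : 1 ≤ j) (hper : (curveMap ω η ^ j) p = p) :
    ∃ k : ℤ, 1 ≤ k ∧ ¬(((curveMap ω η ^ k) p).1.1 ∈ Kset ω ∧
      ((curveMap ω η ^ k) p).1.2 ∈ Kset η) := by
  by_contra! h
  have hQ (k : ℤ) : (curveMap ω η ^ (k + 1)) p = curveMap ω η ((curveMap ω η ^ k) p) := by
    rw [add_comm, zpow_one_add, Equiv.Perm.mul_apply]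
  have hperiod : Function.Periodic (fun k : ℤ => (curveMap ω η ^ k) p) j := fun k => by
    simp only [zpow_add, Equiv.Perm.mul_apply, hper]
  have hpos (k : ℤ) :
      ∃ i : ℕ, 1 ≤ i ∧ (curveMap ω η ^ k) p = (curveMap ω η ^ (i : ℤ)) p := by
    refine ⟨(k % j + j).toNat, ?_, ?_⟩
    · have := Int.emod_nonneg k (by omega : j ≠ 0)
      omega
    · have := Int.emod_nonneg k (by omega : j ≠ 0)
      rw [Int.toNat_of_nonneg (by omega), Int.emod_def, mul_comm]
      refine ((hperiod _).trans ?_).symm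
      exact hperiod.sub_int_mul_eq _
  have hN (i : ℕ) : ((curveMap ω η ^ (i : ℤ)) p).2 ∈ Nset := by
    induction i with
    | zero => simpa using hp
    | succ i ih =>
      rw [Nat.cast_succ, hQ]
      exact Nset_curveMap ih
  refine false_of_orbit_in_Kset (by omega) hperiod hQ (fun k => ?_) (fun k => ?_) fun k => ?_ <;>
    obtain ⟨i, hi, hk⟩ := hpos k <;> simp only [hk]
  · exact hN i
  · exact (h i (by omega)).1
  · exact (h i (by omega)).2

end Periodic

theorem biUnbounded_of_not_bdd {ω : Om} (h : ¬BddAbove (Kset ω) ∧ ¬BddBelow (Kset ω)) :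
    BiUnbounded ω := by
  rw [not_bddAbove_iff, not_bddBelow_iff] at h
  exact ⟨fun x => (h.1 x).imp fun _ hy => ⟨hy.1, hy.2.le⟩,
    fun x => (h.2 x).imp fun _ hy => ⟨hy.1, hy.2.le⟩⟩

/-- Theorem 4.2 (3)–(4). Suppose `K(ω)` and `K(η)` are unbounded above
and below, and let `𝒞` be the curve following map of `τ_{ω,η}` (a bijection, so negative
iterates are defined). Then for `((m,n),v) ∈ ℤ² × N` the following are equivalent:
(a) no forward iterate lies in `K̄ × N`; (b) no backward iterate lies in `K̄ × N`;
(c) `𝒞⁴((m,n),v) = ((m,n),v)`. Moreover, a `𝒞`-periodic point has an iterate whose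
`ℤ²`-component lies outside `K̄`. -/
theorem tiling_renormalization_loops (ω η : Om)
    (hω : ¬BddAbove (Kset ω) ∧ ¬BddBelow (Kset ω))
    (hη : ¬BddAbove (Kset η) ∧ ¬BddBelow (Kset η))
    (p : (ℤ × ℤ) × (ℤ × ℤ)) (hp : p.2 ∈ Nset) :
    ((∀ k : ℤ, 1 ≤ k → ¬ inKN ω η (((curveEquiv (fun q => ω q.1 * η q.2)) ^ k) p)) ↔
      ((curveEquiv (fun q => ω q.1 * η q.2)) ^ (4 : ℤ)) p = p) ∧
    ((∀ k : ℤ, k ≤ -1 → ¬ inKN ω η (((curveEquiv (fun q => ω q.1 * η q.2)) ^ k) p)) ↔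
      ((curveEquiv (fun q => ω q.1 * η q.2)) ^ (4 : ℤ)) p = p) ∧
    ((∃ j : ℤ, 1 ≤ j ∧ ((curveEquiv (fun q => ω q.1 * η q.2)) ^ j) p = p) →
      ∃ k : ℤ, 1 ≤ k ∧
        ¬((((curveEquiv (fun q => ω q.1 * η q.2)) ^ k) p).1.1 ∈ Kset ω ∧
          (((curveEquiv (fun q => ω q.1 * η q.2)) ^ k) p).1.2 ∈ Kset η)) := by
  have hω' := biUnbounded_of_not_bdd hω
  have hη' := biUnbounded_of_not_bdd hη
  have h4 : (curveMap ω η ^ (4 : ℤ)) p = (curveMap ω η)^[4] p := by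
    rw [Equiv.Perm.iterate_eq_pow]
    rfl
  refine ⟨?_, ?_, fun ⟨j, hj, hper⟩ => exists_not_mem_of_periodic hp hj hper⟩
  · rw [h4, ← forward_iff_loop hω' hη' hp]
    refine ⟨fun h k hk => ?_, fun h k hk => ?_⟩
    · rw [Equiv.Perm.iterate_eq_pow, ← zpow_natCast]
      exact h k (by omega)
    · lift k to ℕ using by omega
      rw [zpow_natCast, ← Equiv.Perm.iterate_eq_pow]
      exact h k (by omega)
  · rw [h4, ← backward_iff_loop hω' hη' hp]
    refine ⟨fun h k hk => h _ (by omega), fun h k hk => ?_⟩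
    obtain ⟨i, rfl⟩ := Int.exists_eq_neg_ofNat (by omega : k ≤ 0)
    exact h i (by omega)
end

section
/- A point (ω,η,v) ∈ X has a stable periodic orbit under Φ if and only if there exists k ≥ 1 with 𝒞^k((0,0),v) = ((0,0),v), where 𝒞 is the curve following map of τ_{ω,η}. -/
/-- `X = Ω± × Ω± × N`. -/
abbrev XSp : Type := Om × Om × (ℤ × ℤ)

/-- `σ^k`: the `k`-th power of the shift map, `(σ^k ω)_n = ω_{n+k}`. -/
def shiftBy (k : ℤ) (ω : Om) : Om := fun n => ω (n + k)

/-- The map `Φ : X → X`, `Φ(ω, η, (a,b)) = (σ^{sb}(ω), σ^{sa}(η), (sb, sa))` where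
`s = ω₀·η₀`. -/
def Phi (p : XSp) : XSp :=
  (shiftBy (((p.1 0 * p.2.1 0 : ℤˣ) : ℤ) * p.2.2.2) p.1,
   shiftBy (((p.1 0 * p.2.1 0 : ℤˣ) : ℤ) * p.2.2.1) p.2.1,
   (((p.1 0 * p.2.1 0 : ℤˣ) : ℤ) * p.2.2.2, ((p.1 0 * p.2.1 0 : ℤˣ) : ℤ) * p.2.2.1))

/-- The point `x = (ω,η,v)` is fixed by `Φⁿ` stably: there are open neighborhoods `U ∋ ω`,
`V ∋ η` such that `Φⁿ(ω2,η2,v) = (ω2,η2,v)` for all `ω2 ∈ U`, `η2 ∈ V`. -/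
def stablyFixedBy (x : XSp) (n : ℕ) : Prop :=
  ∃ U V : Set Om, IsOpen U ∧ IsOpen V ∧ x.1 ∈ U ∧ x.2.1 ∈ V ∧
    ∀ ω2 ∈ U, ∀ η2 ∈ V, Phi^[n] (ω2, η2, x.2.2) = (ω2, η2, x.2.2)

/-- `x` has a stable periodic orbit of period `n`: `n` is the smallest positive integer
such that `x` is stably fixed by `Φⁿ`. -/
def hasStablePeriodicOrbitOfPeriod (x : XSp) (n : ℕ) : Prop :=
  0 < n ∧ stablyFixedBy x n ∧ ∀ m : ℕ, 0 < m → stablyFixedBy x m → n ≤ m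

/-- `x` has a stable periodic orbit (of some period). -/
def hasStablePeriodicOrbit (x : XSp) : Prop :=
  ∃ n : ℕ, hasStablePeriodicOrbitOfPeriod x n

open Filter Topology

theorem shiftBy_zero (ω : Om) : shiftBy 0 ω = ω := by
  funext n
  simp [shiftBy]

/-- Following the curve of `τ_{ω,η}` and shifting by the resulting displacement computes the
orbit of `Φ`. -/
theorem Phi_iterate (ω η : Om) (v : ℤ × ℤ) (k : ℕ) :
    Phi^[k] (ω, η, v) =
      (shiftBy ((curve (fun q => ω q.1 * η q.2))^[k] ((0, 0), v)).1.1 ω,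
       shiftBy ((curve (fun q => ω q.1 * η q.2))^[k] ((0, 0), v)).1.2 η,
       ((curve (fun q => ω q.1 * η q.2))^[k] ((0, 0), v)).2) := by
  induction k with
  | zero => simp [shiftBy_zero]
  | succ k ih =>
    rw [Function.iterate_succ_apply', Function.iterate_succ_apply', ih]
    ext n <;> simp [Phi, curve, shiftBy, add_comm, add_left_comm]

/-- Finitely many steps along the curve depend only on finitely many signs. -/
theorem eventually_curve_iterate_eq (p : Om × Om) (x : (ℤ × ℤ) × (ℤ × ℤ)) (k : ℕ) :
    ∀ᶠ p' : Om × Om in 𝓝 p, (curve (fun q => p'.1 q.1 * p'.2 q.2))^[k] x =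
      (curve (fun q => p.1 q.1 * p.2 q.2))^[k] x := by
  induction k with
  | zero => simp
  | succ k ih =>
    set y := (curve (fun q => p.1 q.1 * p.2 q.2))^[k] x with hy
    have hτ : ∀ᶠ p' : Om × Om in 𝓝 p, p'.1 y.1.1 * p'.2 y.1.2 = p.1 y.1.1 * p.2 y.1.2 := by
      have hc : Continuous fun p' : Om × Om => p'.1 y.1.1 * p'.2 y.1.2 := by fun_prop
      simpa only [nhds_discrete, tendsto_pure] using hc.tendsto p
    filter_upwards [ih, hτ] with p' h1 h2
    rw [Function.iterate_succ_apply', Function.iterate_succ_apply', h1, ← hy]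
    simp only [curve, h2]

theorem stablyFixedBy_iff_eventually (ω η : Om) (v : ℤ × ℤ) (n : ℕ) :
    stablyFixedBy (ω, η, v) n ↔
      ∀ᶠ p : Om × Om in 𝓝 (ω, η), Phi^[n] (p.1, p.2, v) = (p.1, p.2, v) := by
  rw [Filter.Eventually, mem_nhds_prod_iff']
  constructor
  · rintro ⟨U, V, hU, hV, hω, hη, h⟩
    exact ⟨U, V, hU, hω, hV, hη, fun p hp => h p.1 hp.1 p.2 hp.2⟩
  · rintro ⟨U, V, hU, hω, hV, hη, h⟩
    exact ⟨U, V, hU, hV, hω, hη, fun a ha b hb => h (Set.mk_mem_prod ha hb)⟩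

/-- No nontrivial power of the shift is locally the identity. -/
theorem eq_zero_of_eventually_shiftBy_eq {ω : Om} {m : ℤ}
    (h : ∀ᶠ ω' in 𝓝 ω, shiftBy m ω' = ω') : m = 0 := by
  by_contra hm
  have ht : Tendsto (fun j : ℤ => Function.update ω j (-ω j)) cofinite (𝓝 ω) := by
    refine tendsto_pi_nhds.2 fun i => tendsto_nhds_of_eventually_eq ?_
    filter_upwards [(Set.finite_singleton i).compl_mem_cofinite] with j hj
    exact Function.update_of_ne (Ne.symm hj) _ _
  obtain ⟨j, hj⟩ := (ht.eventually h).exists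
  have h1 := congrFun hj j
  have h2 := congrFun h.self_of_nhds j
  simp only [shiftBy] at h1 h2
  rw [Function.update_self, Function.update_of_ne (by simpa using hm), h2] at h1
  exact units_ne_neg_self (ω j) h1

theorem stablyFixedBy_iff_curve_iterate (ω η : Om) (v : ℤ × ℤ) (n : ℕ) :
    stablyFixedBy (ω, η, v) n ↔
      (curve (fun q => ω q.1 * η q.2))^[n] ((0, 0), v) = ((0, 0), v) := by
  rw [stablyFixedBy_iff_eventually]
  have hc := eventually_curve_iterate_eq (ω, η) ((0, 0), v) n
  constructor
  · intro h
    have hs := hc.and h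
    simp only [Phi_iterate, Prod.mk.injEq] at hs
    have h1 := eq_zero_of_eventually_shiftBy_eq <|
      ((Continuous.prodMk_left η).continuousAt.eventually hs).mono
        fun _ hp => hp.1 ▸ hp.2.1
    have h2 := eq_zero_of_eventually_shiftBy_eq <|
      ((Continuous.prodMk_right ω).continuousAt.eventually hs).mono
        fun _ hp => hp.1 ▸ hp.2.2.1
    exact Prod.ext (Prod.ext h1 h2) hs.self_of_nhds.2.2.2
  · intro h
    filter_upwards [hc] with p hp
    rw [Phi_iterate, hp, h]
    simp [shiftBy_zero]

/-- Stability Proposition, part 1. A point `(ω,η,v) ∈ X` has a stable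
periodic orbit under `Φ` if and only if the curve of the tiling `[τ_{ω,η}]` through the
normal `v` at the origin is closed, i.e. `𝒞^k((0,0),v) = ((0,0),v)` for some `k ≥ 1`. -/
theorem stable_iff_closed_curve (ω η : Om) (v : ℤ × ℤ) (hv : v ∈ Nset) :
    hasStablePeriodicOrbit (ω, η, v) ↔
      ∃ k : ℕ, 1 ≤ k ∧
        (curve (fun q => ω q.1 * η q.2))^[k] ((0, 0), v) = ((0, 0), v) := by
  classical
  simp only [← stablyFixedBy_iff_curve_iterate]
  constructor
  · rintro ⟨n, hn, h, -⟩
    exact ⟨n, hn, h⟩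
  · intro h
    exact ⟨Nat.find h, (Nat.find_spec h).1, (Nat.find_spec h).2,
      fun m hm hs => Nat.find_min' h ⟨hm, hs⟩⟩
end

section
/- If μ and μ' are shift-invariant Borel probability measures on Ω± and μ_N is the uniform probability measure on N (assigning mass 1/4 to each element), then the product measure μ × μ' × μ_N on X is Φ-invariant: (μ × μ' × μ_N)(Φ⁻¹(A)) = (μ × μ' × μ_N)(A) for every measurable A ⊆ X. -/
open MeasureTheory
open scoped ENNReal

/-- The shift map `σ : Ω± → Ω±`, `σ(ω)_n = ω_{n+1}`. -/
def shiftMap : Om → Om := shiftBy 1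

/-- The uniform probability measure on `N = {(1,0),(−1,0),(0,1),(0,−1)}`, assigning
mass `1/4` to each element. -/
noncomputable def mN : Measure (ℤ × ℤ) :=
  (4 : ℝ≥0∞)⁻¹ • (Measure.dirac ((1:ℤ), (0:ℤ)) + Measure.dirac ((-1:ℤ), (0:ℤ)) +
    Measure.dirac ((0:ℤ), (1:ℤ)) + Measure.dirac ((0:ℤ), (-1:ℤ)))

lemma shiftBy_add (k l : ℤ) : shiftBy (k + l) = shiftBy l ∘ shiftBy k := by
  funext ω n
  simp [shiftBy, add_comm, add_left_comm]

lemma shiftBy_zero_s12 : shiftBy 0 = id := by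
  funext ω n
  simp [shiftBy]

lemma measurable_shiftBy (k : ℤ) : Measurable (shiftBy k) :=
  measurable_pi_lambda _ fun n => measurable_pi_apply (n + k)

/-- A shift-invariant measure is preserved by every power of the shift. -/
lemma measurePreserving_shiftBy {μ : Measure Om}
    (hμ : ∀ A : Set Om, MeasurableSet A → μ (shiftMap ⁻¹' A) = μ A) (k : ℤ) :
    MeasurePreserving (shiftBy k) μ μ := by
  have h_one : MeasurePreserving (shiftBy 1) μ μ :=
    ⟨measurable_shiftBy 1, Measure.ext fun A hA => by
      rw [Measure.map_apply (measurable_shiftBy 1) hA]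
      exact hμ A hA⟩
  have h_neg : MeasurePreserving (shiftBy (-1)) μ μ := by
    refine ⟨measurable_shiftBy _, ?_⟩
    conv_lhs => rw [← h_one.map_eq]
    rw [Measure.map_map (measurable_shiftBy _) (measurable_shiftBy _), ← shiftBy_add,
      add_neg_cancel, shiftBy_zero_s12, Measure.map_id]
  induction k using Int.induction_on with
  | zero => exact shiftBy_zero_s12 ▸ MeasurePreserving.id μ
  | succ i ih => exact shiftBy_add i 1 ▸ h_one.comp ih
  | pred i ih => exact sub_eq_add_neg (-(i : ℤ)) 1 ▸ shiftBy_add (-i) (-1) ▸ h_neg.comp ih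

instance isProbabilityMeasure_mN : IsProbabilityMeasure mN :=
  ⟨by
    simp only [mN, Measure.smul_apply, Measure.add_apply, measure_univ, smul_eq_mul]
    norm_num
    exact ENNReal.inv_mul_cancel (by norm_num) (by norm_num)⟩

/-- Swapping the coordinates and multiplying by a sign permutes the four atoms of `mN`. -/
lemma map_sign_swap_mN (s : ℤˣ) :
    mN.map (fun n : ℤ × ℤ => ((s : ℤ) * n.2, (s : ℤ) * n.1)) = mN := by
  have hm : Measurable (fun n : ℤ × ℤ => ((s : ℤ) * n.2, (s : ℤ) * n.1)) :=
    measurable_of_countable _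
  simp only [mN, Measure.map_smul, Measure.map_add _ _ hm, Measure.map_dirac]
  rcases Int.units_eq_one_or s with rfl | rfl <;> simp <;> abel

lemma measurable_coe_sign : Measurable (fun q : Om × Om => ((q.1 0 * q.2 0 : ℤˣ) : ℤ)) := by
  simp only [Units.val_mul]
  have hv : Measurable ((↑) : ℤˣ → ℤ) := comap_measurable _
  exact (hv.comp ((measurable_pi_apply 0).comp measurable_fst)).mul
    (hv.comp ((measurable_pi_apply 0).comp measurable_snd))

/-- `Φ` first replaces `(a, b)` by `(sb, sa)` over each `(ω, η)`, then shifts `(ω, η)` by the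
new direction; both steps are skew products preserving the measure. -/
lemma measurePreserving_Phi {μ μ' : Measure Om} [IsProbabilityMeasure μ] [IsProbabilityMeasure μ']
    (hμ : ∀ A : Set Om, MeasurableSet A → μ (shiftMap ⁻¹' A) = μ A)
    (hμ' : ∀ A : Set Om, MeasurableSet A → μ' (shiftMap ⁻¹' A) = μ' A) :
    MeasurePreserving Phi (μ.prod (μ'.prod mN)) (μ.prod (μ'.prod mN)) := by
  have h_turn : MeasurePreserving
      (fun p : (Om × Om) × (ℤ × ℤ) =>
        (p.1, (((p.1.1 0 * p.1.2 0 : ℤˣ) : ℤ) * p.2.2, ((p.1.1 0 * p.1.2 0 : ℤˣ) : ℤ) * p.2.1)))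
      ((μ.prod μ').prod mN) ((μ.prod μ').prod mN) := by
    refine (MeasurePreserving.id (μ.prod μ')).skew_product
      (g := fun (q : Om × Om) (n : ℤ × ℤ) => (((q.1 0 * q.2 0 : ℤˣ) : ℤ) * n.2, ((q.1 0 * q.2 0 : ℤˣ) : ℤ) * n.1))
      ?_ (.of_forall fun q => map_sign_swap_mN _)
    have hs : Measurable (fun p : (Om × Om) × (ℤ × ℤ) => ((p.1.1 0 * p.1.2 0 : ℤˣ) : ℤ)) :=
      measurable_coe_sign.comp measurable_fst
    exact (hs.mul (measurable_snd.comp measurable_snd)).prodMk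
      (hs.mul (measurable_fst.comp measurable_snd))
  have h_move : MeasurePreserving
      (fun p : (ℤ × ℤ) × (Om × Om) => (p.1, (shiftBy p.1.1 p.2.1, shiftBy p.1.2 p.2.2)))
      (mN.prod (μ.prod μ')) (mN.prod (μ.prod μ')) := by
    refine (MeasurePreserving.id mN).skew_product
      (g := fun (n : ℤ × ℤ) (q : Om × Om) => (shiftBy n.1 q.1, shiftBy n.2 q.2)) ?_ (.of_forall fun n =>
        ((measurePreserving_shiftBy hμ n.1).prod (measurePreserving_shiftBy hμ' n.2)).map_eq)
    exact measurable_from_prod_countable_right fun n =>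
      ((measurable_shiftBy n.1).comp measurable_fst).prodMk
        ((measurable_shiftBy n.2).comp measurable_snd)
  have h_assoc := measurePreserving_prodAssoc μ μ' mN
  exact h_assoc.comp <| Measure.measurePreserving_swap.comp <| h_move.comp <|
    Measure.measurePreserving_swap.comp <| h_turn.comp <| h_assoc.symm

/-- If `μ` and `μ'` are shift-invariant Borel probability measures on
`Ω±` and `μ_N` is the uniform probability measure on `N`, then `μ × μ' × μ_N` is
`Φ`-invariant. -/
theorem product_measure_Phi_invariant (μ μ' : Measure Om)
    [IsProbabilityMeasure μ] [IsProbabilityMeasure μ']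
    (hμ : ∀ A : Set Om, MeasurableSet A → μ (shiftMap ⁻¹' A) = μ A)
    (hμ' : ∀ A : Set Om, MeasurableSet A → μ' (shiftMap ⁻¹' A) = μ' A) :
    ∀ A : Set XSp, MeasurableSet A →
      (μ.prod (μ'.prod mN)) (Phi ⁻¹' A) = (μ.prod (μ'.prod mN)) A := by
  exact fun A hA => (measurePreserving_Phi hμ hμ').measure_preimage hA.nullMeasurableSet
end

section
/- Let α ∈ [0,1/2) and let C_α = [α,1−α) ⊂ ℝ/ℤ. Then every point of C_α returns to C_α under positive iteration of T_α, so the first return map T̂_α of T_α to C_α is defined on all of C_α; for every x ∈ C_α (identified with its representative in [α,1−α)), T̂_α(x) is the unique point of [α,1−α) congruent to x + α modulo 1−2α; and for α ∈ (0,1/2), ψ_α ∘ T̂_α = T_{f(α)} ∘ ψ_α on C_α. -/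
open scoped Classical

/-- The circle `ℝ/ℤ`. -/
noncomputable abbrev T1 : Type := AddCircle (1:ℝ)

/-- The canonical representative in `[0,1)` of a point of `ℝ/ℤ`. -/
noncomputable def rep1 (x : T1) : ℝ := (AddCircle.equivIco 1 0 x : ℝ)

/-- The rotation `T_α : ℝ/ℤ → ℝ/ℤ`, `x ↦ x + α (mod 1)`. -/
noncomputable def rot (α : ℝ) (x : T1) : T1 := x + (α : T1)

/-- The map `f : [0,1/2) → [0,1/2]`, the reduction of `t/(1−2t)` modulo the group of
isometries of `ℝ` preserving `ℤ`: it equals `r·(t/(1−2t) − n)` for suitable `n ∈ ℤ`,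
`r ∈ {1,−1}`. -/
noncomputable def fmap (t : ℝ) : ℝ :=
  if Int.fract (t / (1 - 2*t)) ≤ 1/2 then Int.fract (t / (1 - 2*t))
  else 1 - Int.fract (t / (1 - 2*t))

/-- The dilation `ψ_t : [t,1−t) → ℝ/ℤ`, defined on representatives `x ∈ [t,1−t)`. -/
noncomputable def psiMap (t : ℝ) (x : ℝ) : T1 :=
  if ∃ n : ℤ, (n : ℝ) ≤ t / (1 - 2*t) ∧ t / (1 - 2*t) < n + 1/2
  then (((x - 1/2) / (1 - 2*t) + 1/2 : ℝ) : T1)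
  else (((1/2 - x) / (1 - 2*t) : ℝ) : T1)

theorem coe_rep1 (x : T1) : ((rep1 x : ℝ) : T1) = x :=
  (AddCircle.equivIco 1 0).symm_apply_apply x

theorem rep1_mem_Ico (x : T1) : rep1 x ∈ Set.Ico (0 : ℝ) 1 := by
  have h := (AddCircle.equivIco (1 : ℝ) 0 x).2
  exact ⟨h.1, h.2.trans_eq (zero_add 1)⟩

theorem rep1_coe_of_mem_Ico {r : ℝ} (h : r ∈ Set.Ico (0 : ℝ) 1) : rep1 (r : T1) = r := by
  have h' : r ∈ Set.Ico (0 : ℝ) (0 + 1) := by rwa [zero_add]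
  exact congrArg Subtype.val ((AddCircle.equivIco (1 : ℝ) 0).apply_symm_apply ⟨r, h'⟩)

theorem coe_intCast_T1 (n : ℤ) : (((n : ℝ)) : T1) = 0 :=
  (AddCircle.coe_eq_zero_iff 1).2 ⟨n, by simp⟩

theorem coe_eq_coe_of_sub_eq_intCast {a b : ℝ} (n : ℤ) (h : a - b = n) :
    (a : T1) = (b : T1) := by
  rw [← sub_eq_zero, ← AddCircle.coe_sub, h, coe_intCast_T1]

theorem rot_iterate_coe (α r : ℝ) (k : ℕ) :
    (rot α)^[k] (r : T1) = ((r + k * α : ℝ) : T1) := by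
  induction k with
  | zero => simp
  | succ k ih =>
    rw [Function.iterate_succ_apply', ih, rot, ← AddCircle.coe_add]
    congr 1
    push_cast
    ring

/-- The orbit of `x` at time `k` has representative `y` as soon as `y ∈ [0,1)` differs from
`rep1 x + k * α` by an integer. -/
theorem rep1_rot_iterate {α y : ℝ} {x : T1} {k : ℕ} (n : ℤ) (hy : y ∈ Set.Ico (0 : ℝ) 1)
    (h : rep1 x + k * α - y = n) : rep1 ((rot α)^[k] x) = y := by
  rw [← rep1_coe_of_mem_Ico hy, ← coe_eq_coe_of_sub_eq_intCast n h, ← rot_iterate_coe, coe_rep1]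

/-- Two points of `[a, a+d)` congruent modulo `d` are equal. -/
theorem eq_of_mem_Ico_of_sub_eq_intCast_mul {a d y z : ℝ} (hd : 0 < d)
    (hy : y ∈ Set.Ico a (a + d)) (hz : z ∈ Set.Ico a (a + d)) (i : ℤ) (h : y - z = i * d) :
    y = z := by
  obtain ⟨hy1, hy2⟩ := hy
  obtain ⟨hz1, hz2⟩ := hz
  have h1 : (i : ℝ) < 1 := by
    by_contra! hc
    nlinarith
  have h2 : (-1 : ℝ) < i := by
    by_contra! hc
    nlinarith
  have h1' : i < 1 := by exact_mod_cast h1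
  have h2' : -1 < i := by exact_mod_cast h2
  obtain rfl : i = 0 := by lia
  simp only [Int.cast_zero, zero_mul] at h
  linarith

theorem psiMap_add_sub_intCast_mul {t : ℝ} (ht : t < 1 / 2) (x : ℝ) (m : ℤ) :
    psiMap t (x + t - m * (1 - 2 * t)) = rot (fmap t) (psiMap t x) := by
  have hd : 1 - 2 * t ≠ 0 := by linarith
  have hfr := Int.floor_add_fract (t / (1 - 2 * t))
  by_cases hc : ∃ n : ℤ, (n : ℝ) ≤ t / (1 - 2*t) ∧ t / (1 - 2*t) < n + 1/2
  · obtain ⟨n, hn1, hn2⟩ := id hc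
    have hn : ⌊t / (1 - 2 * t)⌋ = n := Int.floor_eq_iff.2 ⟨hn1, by linarith⟩
    rw [hn] at hfr
    have hle : Int.fract (t / (1 - 2 * t)) ≤ 1 / 2 := by linarith
    rw [psiMap, psiMap, fmap, if_pos hc, if_pos hc, if_pos hle, rot, ← AddCircle.coe_add]
    refine coe_eq_coe_of_sub_eq_intCast (n - m) ?_
    have : (x + t - m * (1 - 2 * t) - 1 / 2) / (1 - 2 * t)
        = (x - 1 / 2) / (1 - 2 * t) + t / (1 - 2 * t)
          - m * (1 - 2 * t) / (1 - 2 * t) := by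
      ring
    rw [this, mul_div_cancel_right₀ _ hd]
    push_cast
    linarith
  · have hge : 1 / 2 ≤ Int.fract (t / (1 - 2 * t)) := by
      by_contra! hlt
      exact hc ⟨⌊t / (1 - 2 * t)⌋, Int.floor_le _, by linarith⟩
    have hf : fmap t = 1 - Int.fract (t / (1 - 2 * t)) := by
      rw [fmap]
      split_ifs <;> linarith
    rw [psiMap, psiMap, hf, if_neg hc, if_neg hc, rot, ← AddCircle.coe_add]
    refine coe_eq_coe_of_sub_eq_intCast (m - ⌊t / (1 - 2 * t)⌋ - 1) ?_
    have : (1 / 2 - (x + t - m * (1 - 2 * t))) / (1 - 2 * t)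
        = (1 / 2 - x) / (1 - 2 * t) - t / (1 - 2 * t)
          + m * (1 - 2 * t) / (1 - 2 * t) := by
      ring
    rw [this, mul_div_cancel_right₀ _ hd]
    push_cast
    linarith

/-- Rotation renormalization. Let `α ∈ [0,1/2)` and
`C_α = [α,1−α) ⊂ ℝ/ℤ`. Every point of `C_α` returns to `C_α` under positive iteration of
`T_α` (so the first return map `T̂_α` is defined on all of `C_α`); the first return
`T̂_α(x)` is the unique point of `[α,1−α)` congruent to `x + α` modulo `1−2α`; and, when
`α ∈ (0,1/2)`, `ψ_α ∘ T̂_α = T_{f(α)} ∘ ψ_α` on `C_α`. -/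
theorem rotation_renormalization (α : ℝ) (h0 : 0 ≤ α) (h1 : α < 1/2) :
    ∀ x : T1, rep1 x ∈ Set.Ico α (1 - α) →
      ∃ k : ℕ, 1 ≤ k ∧
        rep1 ((rot α)^[k] x) ∈ Set.Ico α (1 - α) ∧
        (∀ j : ℕ, 1 ≤ j → j < k → rep1 ((rot α)^[j] x) ∉ Set.Ico α (1 - α)) ∧
        (∃ i : ℤ, rep1 ((rot α)^[k] x) - (rep1 x + α) = i * (1 - 2*α)) ∧
        (∀ y : ℝ, y ∈ Set.Ico α (1 - α) → (∃ i : ℤ, y - (rep1 x + α) = i * (1 - 2*α)) →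
          y = rep1 ((rot α)^[k] x)) ∧
        (0 < α → psiMap α (rep1 ((rot α)^[k] x)) = rot (fmap α) (psiMap α (rep1 x))) := by
  intro x hx
  obtain ⟨hx1, hx2⟩ := hx
  have hd : 0 < 1 - 2 * α := by linarith
  have hx0 : 0 ≤ rep1 x := (rep1_mem_Ico x).1
  set m : ℕ := ⌊rep1 x / (1 - 2 * α)⌋₊ with hm
  have hm1 : (m : ℝ) * (1 - 2 * α) ≤ rep1 x :=
    (le_div_iff₀ hd).1 (Nat.floor_le (div_nonneg hx0 hd.le))
  have hm2 : rep1 x < (m + 1) * (1 - 2 * α) :=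
    (div_lt_iff₀ hd).1 (Nat.lt_floor_add_one _)
  have hy : rep1 ((rot α)^[2 * m + 1] x) = rep1 x + α - m * (1 - 2 * α) := by
    refine rep1_rot_iterate m ⟨by linarith, by linarith⟩ ?_
    push_cast
    ring
  have hmem : rep1 x + α - m * (1 - 2 * α) ∈ Set.Ico α (1 - α) :=
    ⟨by linarith, by linarith⟩
  refine ⟨2 * m + 1, by lia, hy ▸ hmem, ?_, ⟨-m, ?_⟩, ?_, fun _ => ?_⟩
  · intro j hj1 hj2
    obtain ⟨i, hi⟩ | ⟨i, hi⟩ : (∃ i, j = 2 * i + 1) ∨ ∃ i, j = 2 * i + 2 := by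
      obtain ⟨i, hi | hi⟩ := Nat.even_or_odd' (j - 1)
      · exact Or.inl ⟨i, by lia⟩
      · exact Or.inr ⟨i, by lia⟩
    all_goals
      subst hi
      have him : (i : ℝ) + 1 ≤ m := by
        have : i + 1 ≤ m := by lia
        exact_mod_cast this
      have hlow : ((i : ℝ) + 1) * (1 - 2 * α) ≤ rep1 x :=
        (mul_le_mul_of_nonneg_right him hd.le).trans hm1
      have hnn : 0 ≤ (i : ℝ) * (1 - 2 * α) := by positivity
    · have h : rep1 ((rot α)^[2 * i + 1] x) = rep1 x + α - i * (1 - 2 * α) := by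
        refine rep1_rot_iterate i ⟨by linarith, by linarith⟩ ?_
        push_cast
        ring
      rw [h]
      rintro ⟨-, h2⟩
      linarith
    · have h : rep1 ((rot α)^[2 * i + 2] x) = rep1 x + 2 * α - 1 - i * (1 - 2 * α) := by
        refine rep1_rot_iterate (i + 1) ⟨by linarith, by linarith⟩ ?_
        push_cast
        ring
      rw [h]
      rintro ⟨h2, -⟩
      linarith
  · rw [hy]
    push_cast
    ring
  · rintro y hyI ⟨i, hi⟩
    have hI : α + (1 - 2 * α) = 1 - α := by ring
    rw [hy]
    refine eq_of_mem_Ico_of_sub_eq_intCast_mul (a := α) hd (hI ▸ hyI) (hI ▸ hmem) (i + m) ?_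
    push_cast
    linarith
  · rw [hy]
    exact psiMap_add_sub_intCast_mul h1 (rep1 x) m
end

section
/- Let 0 ≤ α < 1/2. Then μ_α(c⁻¹(B)) = (1−2α)·μ_{f(α)}(B) for every Borel set B ⊆ Ω±; that is, the pushforward of the restriction of μ_α to the collapsible sequences under the collapsing map c equals (1−2α)·μ_{f(α)}. -/
open MeasureTheory
open scoped Classical ENNReal

/-- The coding `ς_α : ℝ/ℤ → Ω±` of the rotation by `α`: `ς_α(x)_n = 1` if `x + nα (mod 1)`
has representative in `[0,1/2)`, and `−1` otherwise. -/
noncomputable def code (α : ℝ) (x : T1) : Om := fun n =>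
  if rep1 (x + (((n : ℝ) * α : ℝ) : T1)) < 1/2 then 1 else -1

/-- `μ_α`: the pushforward under `ς_α` of the Haar (Lebesgue) probability measure on
`ℝ/ℤ`. -/
noncomputable def muCode (α : ℝ) : Measure Om :=
  Measure.map (code α) (volume : Measure T1)

/-- The set `C` of collapsible sequences: `K(ω)` has neither an upper nor a lower bound,
and `0 ∈ K(ω)`. -/
def CSet : Set Om :=
  {ω | (¬BddAbove (Kset ω) ∧ ¬BddBelow (Kset ω)) ∧ (0:ℤ) ∈ Kset ω}

/-- The collapsing map `c : C → Ω±` (extended by the identity off `C`): for collapsible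
`ω`, letting `i ↦ k_i` be the unique order-preserving bijection `ℤ → K(ω)` with `k₀ = 0`,
`c(ω)_i = ω_{k_i}`. -/
noncomputable def collapse (ω : Om) : Om :=
  if h : ∃ e : ℤ → ℤ, StrictMono e ∧ e 0 = 0 ∧ Set.range e = Kset ω
  then fun i => ω (h.choose i) else ω

lemma rep1_coe (t : ℝ) : rep1 (t : T1) = Int.fract t := by
  have := AddCircle.coe_equivIco_mk_apply (p := (1:ℝ)) t
  simpa only [rep1, div_one, mul_one] using this

lemma code_coe (α t : ℝ) (n : ℤ) :
    code α (t : T1) n = if Int.fract (t + n * α) < 1 / 2 then 1 else -1 := by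
  rw [code, ← AddCircle.coe_add, rep1_coe]

lemma measurable_rep1 : Measurable rep1 :=
  measurable_subtype_coe.comp (AddCircle.measurableEquivIco (1:ℝ) 0).measurable

lemma measurable_code (α : ℝ) : Measurable (code α) := by
  refine measurable_pi_iff.2 fun n => Measurable.ite ?_ measurable_const measurable_const
  exact measurableSet_lt (measurable_rep1.comp (measurable_id.add_const _)) measurable_const

lemma muCode_apply (α : ℝ) {S : Set Om} (hS : MeasurableSet S) :
    muCode α S = volume (Set.Ico (0:ℝ) 1 ∩ {t : ℝ | code α (t : T1) ∈ S}) := by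
  have h := AddCircle.measurePreserving_mk (1:ℝ) 0
  have hm : MeasurableSet (code α ⁻¹' S) := measurable_code α hS
  rw [muCode, Measure.map_apply (measurable_code α) hS, ← h.measure_preimage hm.nullMeasurableSet,
    zero_add, Measure.restrict_congr_set Ico_ae_eq_Ioc.symm,
    Measure.restrict_apply (h.measurable hm), Set.inter_comm]
  rfl

lemma exists_enum_of_mem_CSet {ω : Om} (h : ω ∈ CSet) :
    ∃ e : ℤ → ℤ, StrictMono e ∧ e 0 = 0 ∧ Set.range e = Kset ω := by
  obtain ⟨⟨ha, hb⟩, h0⟩ := h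
  have : Nonempty (Kset ω) := ⟨⟨0, h0⟩⟩
  have : NoMaxOrder (Kset ω) := ⟨fun a => by
    obtain ⟨b, hb, hab⟩ := not_bddAbove_iff.1 ha a
    exact ⟨⟨b, hb⟩, hab⟩⟩
  have : NoMinOrder (Kset ω) := ⟨fun a => by
    obtain ⟨b, hb, hab⟩ := not_bddBelow_iff.1 hb a
    exact ⟨⟨b, hb⟩, hab⟩⟩
  let _ : LocallyFiniteOrder (Kset ω) := inferInstance
  let _ : SuccOrder (Kset ω) := LinearLocallyFiniteOrder.succOrder _
  let _ : PredOrder (Kset ω) := LinearLocallyFiniteOrder.predOrder _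
  let φ : Kset ω ≃o ℤ := orderIsoIntOfLinearSuccPredArch
  refine ⟨fun i => φ.symm (i + φ ⟨0, h0⟩), fun i j hij => ?_, by simp, ?_⟩
  · exact φ.symm.strictMono (by simpa using hij)
  · ext n
    refine ⟨?_, fun hn => ⟨φ ⟨n, hn⟩ - φ ⟨0, h0⟩, by simp⟩⟩
    rintro ⟨i, rfl⟩
    exact (φ.symm _).2

/-- The number of elements of `K(ω)` in `[0,k)`, or minus that in `[k,0)` for negative `k`. -/
noncomputable def signedCount (ω : Om) (k : ℤ) : ℤ :=
  (∑ n ∈ Finset.Ico 0 k, if n ∈ Kset ω then 1 else 0) -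
    ∑ n ∈ Finset.Ico k 0, if n ∈ Kset ω then 1 else 0

lemma sum_Ico_enum {ω : Om} {e : ℤ → ℤ} (he : StrictMono e) (hr : Set.range e = Kset ω)
    (a b : ℤ) : (∑ n ∈ Finset.Ico (e a) (e b), if n ∈ Kset ω then (1:ℤ) else 0) =
      ((b - a).toNat : ℤ) := by
  have : (Finset.Ico (e a) (e b)).filter (· ∈ Kset ω) = (Finset.Ico a b).image e := by
    ext n
    simp only [Finset.mem_filter, Finset.mem_Ico, Finset.mem_image, ← hr]
    constructor
    · rintro ⟨⟨h1, h2⟩, i, rfl⟩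
      exact ⟨i, ⟨he.le_iff_le.1 h1, he.lt_iff_lt.1 h2⟩, rfl⟩
    · rintro ⟨i, ⟨h1, h2⟩, rfl⟩
      exact ⟨⟨he.le_iff_le.2 h1, he.lt_iff_lt.2 h2⟩, i, rfl⟩
  rw [Finset.sum_boole, this, Finset.card_image_of_injective _ he.injective, Int.card_Ico]

lemma signedCount_enum {ω : Om} {e : ℤ → ℤ} (he : StrictMono e) (h0 : e 0 = 0)
    (hr : Set.range e = Kset ω) (i : ℤ) : signedCount ω (e i) = i := by
  have h1 := sum_Ico_enum he hr 0 i
  have h2 := sum_Ico_enum he hr i 0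
  rw [h0] at h1 h2
  rw [signedCount, h1, h2]
  omega

lemma collapse_eq_of_enum {ω : Om} {e : ℤ → ℤ} (he : StrictMono e) (h0 : e 0 = 0)
    (hr : Set.range e = Kset ω) : collapse ω = fun i => ω (e i) := by
  have h : ∃ e : ℤ → ℤ, StrictMono e ∧ e 0 = 0 ∧ Set.range e = Kset ω := ⟨e, he, h0, hr⟩
  rw [collapse, dif_pos h]
  obtain ⟨h1, h2, h3⟩ := h.choose_spec
  ext1 i
  obtain ⟨j, hj⟩ : h.choose i ∈ Set.range e := by
    have hi : h.choose i ∈ Set.range h.choose := ⟨i, rfl⟩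
    exact (h3.trans hr.symm).subset hi
  have hi := signedCount_enum h1 h2 h3 i
  rw [← hj, signedCount_enum he h0 hr] at hi
  rw [← hj, hi]

lemma collapse_apply_eq_iff {ω : Om} (h : ω ∈ CSet) (i : ℤ) (s : ℤˣ) :
    collapse ω i = s ↔ ∃ k : ℤ, k ∈ Kset ω ∧ signedCount ω k = i ∧ ω k = s := by
  obtain ⟨e, he, h0, hr⟩ := exists_enum_of_mem_CSet h
  rw [collapse_eq_of_enum he h0 hr]
  constructor
  · exact fun hs => ⟨e i, hr ▸ ⟨i, rfl⟩, signedCount_enum he h0 hr i, hs⟩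
  · rintro ⟨k, hk, hki, hs⟩
    obtain ⟨j, rfl⟩ := hr ▸ hk
    rw [signedCount_enum he h0 hr] at hki
    rwa [← hki]

lemma measurableSet_signs (s : Set ℤˣ) : MeasurableSet s :=
  ⟨Units.val '' s, MeasurableSet.of_discrete, Set.preimage_image_eq s Units.val_injective⟩

lemma measurableSet_mem_Kset (n : ℤ) : MeasurableSet {ω : Om | n ∈ Kset ω} := by
  have h (m : ℤ) (s : ℤˣ) : MeasurableSet {ω : Om | ω m = s} :=
    (measurable_pi_apply (X := fun _ : ℤ => ℤˣ) m) (measurableSet_signs {s})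
  exact ((h n (-1)).inter (h (n + 1) 1)).compl.inter ((h (n - 1) (-1)).inter (h n 1)).compl

lemma measurable_signedCount (k : ℤ) : Measurable fun ω => signedCount ω k := by
  unfold signedCount
  refine Measurable.sub ?_ ?_ <;>
  exact Finset.measurable_sum _ fun n _ =>
    Measurable.ite (measurableSet_mem_Kset n) measurable_const measurable_const

lemma measurableSet_CSet : MeasurableSet CSet := by
  have : CSet = ((⋂ m : ℤ, ⋃ n : ℤ, {ω | n ∈ Kset ω ∧ m < n}) ∩
      (⋂ m : ℤ, ⋃ n : ℤ, {ω | n ∈ Kset ω ∧ n < m})) ∩ {ω | 0 ∈ Kset ω} := by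
    ext ω
    simp [CSet, not_bddAbove_iff, not_bddBelow_iff]
  rw [this]
  refine (MeasurableSet.inter ?_ ?_).inter (measurableSet_mem_Kset 0) <;>
  exact MeasurableSet.iInter fun m => MeasurableSet.iUnion fun n =>
    (measurableSet_mem_Kset n).inter (MeasurableSet.const _)

lemma measurableSet_collapse_preimage {B : Set Om} (hB : MeasurableSet B) :
    MeasurableSet (CSet ∩ collapse ⁻¹' B) := by
  have h : Measurable fun ω : CSet => collapse ω := by
    refine measurable_pi_iff.2 fun i => measurable_to_countable' fun s => ?_
    have : (fun ω : CSet => collapse ω i) ⁻¹' {s} = Subtype.val ⁻¹'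
        (⋃ k : ℤ, ({ω | k ∈ Kset ω} ∩ ((signedCount · k) ⁻¹' {i} ∩ {ω : Om | ω k = s}))) := by
      ext ω
      simp [collapse_apply_eq_iff ω.2]
    rw [this]
    exact measurable_subtype_coe (MeasurableSet.iUnion fun k => (measurableSet_mem_Kset k).inter
      ((measurable_signedCount k (measurableSet_singleton i)).inter
        ((measurable_pi_apply (X := fun _ : ℤ => ℤˣ) k) (measurableSet_signs {s}))))
  have := measurableSet_CSet.subtype_image (h hB)
  convert this using 1
  ext ω
  simp [and_comm]

lemma mem_Kset_code_iff {α : ℝ} (h0 : 0 ≤ α) (h1 : α < 1 / 2) (t : ℝ) (n : ℤ) :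
    n ∈ Kset (code α (t : T1)) ↔ ∃ m : ℤ, m + α ≤ t + n * α ∧ t + n * α < m + 1 - α := by
  have hne : ¬ ((-1 : ℤˣ) = 1) := by decide
  have hne' : ¬ ((1 : ℤˣ) = -1) := by decide
  have key (u : ℝ) (k : ℤ) (hk : k ≤ u) (hk' : u < k + 1) : Int.fract u = u - k := by
    rw [Int.fract, Int.floor_eq_iff.2 ⟨hk, hk'⟩]
  have hu0 := Int.floor_le (t + n * α)
  have hu1 := Int.lt_floor_add_one (t + n * α)
  simp only [Kset, Set.mem_ofPred_eq, code_coe, ite_eq_left_iff, ite_eq_right_iff, hne, hne',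
    imp_false, not_not, Int.cast_add, Int.cast_sub, Int.cast_one]
  rw [show t + (n + 1 : ℝ) * α = t + n * α + α by ring,
    show t + (n - 1 : ℝ) * α = t + n * α - α by ring]
  generalize t + n * α = u at *
  set m := ⌊u⌋
  have hf := key u m hu0 hu1
  have hplus : u + α < m + 1 ∧ Int.fract (u + α) = u + α - m ∨
      m + 1 ≤ u + α ∧ Int.fract (u + α) = u + α - (m + 1) := by
    rcases lt_or_ge (u + α) (m + 1) with h | h
    · exact Or.inl ⟨h, key _ m (by linarith) h⟩
    · exact Or.inr ⟨h, by simpa using key (u + α) (m + 1) (by simpa using h) (by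
        push_cast; linarith)⟩
  have hminus : m ≤ u - α ∧ Int.fract (u - α) = u - α - m ∨
      u - α < m ∧ Int.fract (u - α) = u - α - (m - 1) := by
    rcases lt_or_ge (u - α) m with h | h
    · exact Or.inr ⟨h, by simpa using key (u - α) (m - 1) (by push_cast; linarith) (by
        push_cast; linarith)⟩
    · exact Or.inl ⟨h, key _ m h (by linarith)⟩
  rw [hf]
  constructor
  · rintro ⟨ha, hb⟩
    refine ⟨m, ?_, ?_⟩
    · by_contra hc
      rcases hminus with ⟨h, h'⟩ | ⟨h, h'⟩
      · linarith
      · rw [h'] at hb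
        exact hb ⟨by linarith, by linarith⟩
    · by_contra hc
      rcases hplus with ⟨h, h'⟩ | ⟨h, h'⟩
      · linarith
      · rw [h'] at ha
        exact ha ⟨by linarith, by linarith⟩
  · rintro ⟨k, hk, hk'⟩
    obtain rfl : m = k := Int.floor_eq_iff.2 ⟨by linarith, by linarith⟩
    constructor
    · rintro ⟨ha, hb⟩
      rcases hplus with ⟨h, h'⟩ | ⟨h, h'⟩ <;> rw [h'] at hb <;> linarith
    · rintro ⟨ha, hb⟩
      rcases hminus with ⟨h, h'⟩ | ⟨h, h'⟩ <;> rw [h'] at ha <;> linarith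

lemma code_mem_CSet_and_collapse {α : ℝ} (h0 : 0 ≤ α) (h1 : α < 1 / 2) {t : ℝ}
    (ht : α ≤ t) (ht' : t < 1 - α) : code α (t : T1) ∈ CSet ∧
      collapse (code α (t : T1)) = code (α / (1 - 2 * α)) (((t - α) / (1 - 2 * α) : ℝ) : T1) := by
  have hd : 0 < 1 - 2 * α := by linarith
  set β := α / (1 - 2 * α) with hβ
  set y := (t - α) / (1 - 2 * α) with hy
  have hβ' : β * (1 - 2 * α) = α := div_mul_cancel₀ _ hd.ne'
  have hy' : y * (1 - 2 * α) = t - α := div_mul_cancel₀ _ hd.ne'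
  have hβ0 : 0 ≤ β := div_nonneg h0 hd.le
  set m : ℤ → ℤ := fun i => ⌊y + i * β⌋ with hm
  set e : ℤ → ℤ := fun i => i + 2 * m i with he
  have hmono : Monotone m := fun i j hij => Int.floor_mono (by
    have : (i : ℝ) ≤ j := by exact_mod_cast hij
    nlinarith)
  have hmono' : StrictMono e := fun i j hij => by
    have := hmono hij.le
    simp only [he]
    linarith
  have hlin (i : ℤ) : t + (e i) * α - m i - α = (y + i * β - m i) * (1 - 2 * α) := by
    have : (y + i * β - m i) * (1 - 2 * α) =
      y * (1 - 2 * α) + i * (β * (1 - 2 * α)) - m i * (1 - 2 * α) := by ring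
    rw [this, hy', hβ']
    simp only [he]
    push_cast
    ring
  have hfl (i : ℤ) : 0 ≤ y + i * β - m i ∧ y + i * β - m i < 1 :=
    ⟨Int.fract_nonneg (y + i * β), Int.fract_lt_one (y + i * β)⟩
  have hfrac (i : ℤ) : m i + α ≤ t + e i * α ∧ t + e i * α < m i + 1 - α := by
    obtain ⟨ha, hb⟩ := hfl i
    have := hlin i
    constructor <;> nlinarith
  have he0 : e 0 = 0 := by
    have : m 0 = 0 := by
      simp only [hm, Int.cast_zero, zero_mul, add_zero]
      rw [Int.floor_eq_iff]
      constructor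
      · simpa using div_nonneg (by linarith : 0 ≤ t - α) hd.le
      · simpa [hy] using (div_lt_one hd).2 (by linarith : t - α < 1 - 2 * α)
    simp [he, this]
  have hr : Set.range e = Kset (code α (t : T1)) := by
    ext n
    rw [mem_Kset_code_iff h0 h1]
    constructor
    · rintro ⟨i, rfl⟩
      exact ⟨m i, hfrac i⟩
    · rintro ⟨k, hk, hk'⟩
      refine ⟨n - 2 * k, ?_⟩
      have : m (n - 2 * k) = k := by
        have h2 : (y + ((n - 2 * k : ℤ) : ℝ) * β) * (1 - 2 * α) = t + n * α - α - 2 * k * α := by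
          have : (y + ((n - 2 * k : ℤ) : ℝ) * β) * (1 - 2 * α) =
            y * (1 - 2 * α) + (n - 2 * k) * (β * (1 - 2 * α)) := by push_cast; ring
          rw [this, hy', hβ']
          ring
        refine Int.floor_eq_iff.2 ⟨?_, ?_⟩
        · refine le_of_mul_le_mul_right ?_ hd
          rw [h2]
          linarith
        · refine lt_of_mul_lt_mul_right ?_ hd.le
          rw [h2]
          linarith
      simp [he, this]
  refine ⟨⟨⟨?_, ?_⟩, hr ▸ ⟨0, he0⟩⟩, ?_⟩
  · rw [← hr]
    exact hmono'.not_bddAbove_range_of_isSuccArchimedean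
  · rw [← hr]
    exact hmono'.not_bddBelow_range_of_isPredArchimedean
  · rw [collapse_eq_of_enum hmono' he0 hr]
    ext1 i
    have h2 : Int.fract (t + e i * α) = t + e i * α - m i := by
      rw [Int.fract, Int.floor_eq_iff.2]
      exact ⟨by linarith [(hfrac i).1], by linarith [(hfrac i).2]⟩
    rw [code_coe, code_coe, h2]
    congr 1
    have := hlin i
    change _ = (y + i * β - m i < 1 / 2)
    refine propext ⟨fun h => ?_, fun h => ?_⟩
    · refine lt_of_mul_lt_mul_right ?_ hd.le
      rw [← this]
      linarith
    · have := mul_lt_mul_of_pos_right h hd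
      linarith

lemma muCode_CSet_inter_collapse_preimage {α : ℝ} (h0 : 0 ≤ α) (h1 : α < 1 / 2)
    {B : Set Om} (hB : MeasurableSet B) : muCode α (CSet ∩ collapse ⁻¹' B) =
      ENNReal.ofReal (1 - 2 * α) * muCode (α / (1 - 2 * α)) B := by
  have hd : 0 < 1 - 2 * α := by linarith
  rw [muCode_apply α (measurableSet_collapse_preimage hB), muCode_apply _ hB]
  set S := Set.Ico (0:ℝ) 1 ∩ {t : ℝ | code (α / (1 - 2 * α)) (t : T1) ∈ B} with hS
  have : Set.Ico (0:ℝ) 1 ∩ {t : ℝ | code α (t : T1) ∈ CSet ∩ collapse ⁻¹' B} =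
      (fun t => t + -α) ⁻¹' ((fun t => (1 - 2 * α)⁻¹ * t) ⁻¹' S) := by
    ext t
    have hS' : t ∈ (fun t => t + -α) ⁻¹' ((fun t => (1 - 2 * α)⁻¹ * t) ⁻¹' S) ↔
        (α ≤ t ∧ t < 1 - α) ∧
          code (α / (1 - 2 * α)) (((t - α) / (1 - 2 * α) : ℝ) : T1) ∈ B := by
      simp only [Set.mem_preimage, hS, Set.mem_inter_iff, Set.mem_Ico, Set.mem_ofPred_eq]
      rw [show (1 - 2 * α)⁻¹ * (t + -α) = (t - α) / (1 - 2 * α) by ring, div_lt_one hd,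
        le_div_iff₀ hd, zero_mul]
      refine and_congr_left fun _ => and_congr ?_ ?_ <;> constructor <;> intro h <;> linarith
    rw [hS']
    constructor
    · rintro ⟨⟨ht0, ht1⟩, hC, hcB⟩
      obtain ⟨m, hm, hm'⟩ := (mem_Kset_code_iff h0 h1 t 0).1 hC.2
      simp only [Int.cast_zero, zero_mul, add_zero] at hm hm'
      have hm0 : m = 0 := by
        have h2 : (m : ℝ) < 1 := by linarith
        have h3 : (-1 : ℝ) < m := by linarith
        norm_cast at h2 h3
        omega
      subst hm0
      simp only [Int.cast_zero, zero_add] at hm hm'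
      refine ⟨⟨hm, hm'⟩, ?_⟩
      rw [← (code_mem_CSet_and_collapse h0 h1 hm hm').2]
      exact hcB
    · rintro ⟨⟨hm, hm'⟩, hb⟩
      obtain ⟨hC, hc⟩ := code_mem_CSet_and_collapse h0 h1 hm hm'
      refine ⟨⟨by linarith, by linarith⟩, hC, ?_⟩
      rw [Set.mem_preimage, hc]
      exact hb
  rw [this, measure_preimage_add_right, Real.volume_preimage_mul_left (inv_pos.2 hd).ne', inv_inv,
    abs_of_pos hd]

lemma muCode_sub_int (α : ℝ) (k : ℤ) : muCode (α - k) = muCode α := by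
  have : code (α - k) = code α := by
    ext1 x
    obtain ⟨t, rfl⟩ := QuotientAddGroup.mk_surjective x
    ext1 n
    have h : t + n * (α - k) = t + n * α - ((n * k : ℤ) : ℝ) := by push_cast; ring
    change code (α - k) (t : T1) n = code α (t : T1) n
    rw [code_coe, code_coe, h, Int.fract_sub_intCast]
  rw [muCode, this, muCode]

lemma code_neg_half_sub {α t : ℝ} {n : ℤ} (h : ∀ k : ℤ, 2 * (t + n * α) ≠ k) :
    code (-α) ((1 / 2 - t : ℝ) : T1) n = code α (t : T1) n := by
  rw [code_coe, code_coe, show 1 / 2 - t + n * -α = 1 / 2 - (t + n * α) by ring]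
  generalize t + n * α = u at *
  congr 1
  have hu0 := Int.floor_le u
  have hu1 := Int.lt_floor_add_one u
  set m := ⌊u⌋
  have e1 : Int.fract u = u - m := rfl
  have hne0 : u ≠ m := fun hc => h (2 * m) (by push_cast; linarith)
  have hne1 : u ≠ m + 1 / 2 := fun hc => h (2 * m + 1) (by push_cast; linarith)
  have h0 : m < u := lt_of_le_of_ne hu0 hne0.symm
  rw [e1]
  rcases lt_or_gt_of_ne hne1 with h2 | h2
  · have : ⌊1 / 2 - u⌋ = -m := Int.floor_eq_iff.2
      ⟨by push_cast; linarith, by push_cast; linarith⟩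
    refine propext ⟨fun _ => by linarith, fun _ => ?_⟩
    rw [Int.fract, this]
    push_cast
    linarith
  · have : ⌊1 / 2 - u⌋ = -m - 1 := Int.floor_eq_iff.2
      ⟨by push_cast; linarith, by push_cast; linarith⟩
    refine propext ⟨fun hc => ?_, fun hc => by linarith⟩
    rw [Int.fract, this] at hc
    push_cast at hc
    linarith

lemma muCode_neg (α : ℝ) : muCode (-α) = muCode α := by
  have hmp : MeasurePreserving (fun x : T1 => ((1 / 2 : ℝ) : T1) - x) volume volume :=
    Measure.measurePreserving_sub_left volume _
  have : NullSingletonClass (volume : Measure T1) := ⟨fun x => by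
    simpa using AddCircle.volume_closedBall (1:ℝ) (x := x) 0⟩
  have hae : (fun x : T1 => code (-α) (((1 / 2 : ℝ) : T1) - x)) =ᵐ[volume] code α := by
    have hc : (⋃ n : ℤ, ⋃ k : ℤ, {((k / 2 - n * α : ℝ) : T1)}).Countable :=
      Set.countable_iUnion fun n => Set.countable_iUnion fun k => Set.countable_singleton _
    filter_upwards [hc.ae_notMem volume] with x hx
    obtain ⟨t, rfl⟩ := QuotientAddGroup.mk_surjective x
    ext1 n
    change code (-α) (((1 / 2 - t : ℝ) : T1)) n = code α (t : T1) n
    refine code_neg_half_sub fun k hk => hx ?_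
    simp only [Set.mem_iUnion, Set.mem_singleton_iff]
    refine ⟨n, k, ?_⟩
    congr 1
    linarith
  rw [muCode, muCode, ← Measure.map_congr hae]
  nth_rw 1 [← hmp.map_eq]
  exact Measure.map_map (measurable_code _) hmp.measurable

lemma muCode_fmap (α : ℝ) : muCode (fmap α) = muCode (α / (1 - 2 * α)) := by
  rw [fmap]
  split_ifs
  · exact muCode_sub_int _ _
  · rw [← muCode_neg, neg_sub]
    have := muCode_sub_int (α / (1 - 2 * α)) (⌊α / (1 - 2 * α)⌋ + 1)
    rw [← this, Int.fract]
    congr 1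
    push_cast
    ring

/-- Action on measures, Corollary 6.2. For `0 ≤ α < 1/2` and every
Borel set `B ⊆ Ω±`, `μ_α(c⁻¹(B)) = (1−2α)·μ_{f(α)}(B)`, where `c⁻¹(B)` denotes the
preimage of `B` under the collapsing map `c : C → Ω±`. -/
theorem collapse_pushforward_measure (α : ℝ) (h0 : 0 ≤ α) (h1 : α < 1/2) :
    ∀ B : Set Om, MeasurableSet B →
      muCode α (CSet ∩ collapse ⁻¹' B) =
        ENNReal.ofReal (1 - 2*α) * muCode (fmap α) B := by
  intro B hB
  rw [muCode_fmap]
  exact muCode_CSet_inter_collapse_preimage h0 h1 hB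
end

section
/- For all γ, δ ∈ (0,1/2), all m, n ∈ ℤ and r, s ∈ {1,−1} satisfying f(γ) = r·(γ/(1−2γ) − m) and f(δ) = s·(δ/(1−2δ) − n), one has the entrywise inequality in ℝ⁴: (1−2γ)(1−2δ) · N(γ,δ)ᵀ · n_{f(γ),f(δ)} ≤ (1 − (4/3)·f(γ)·f(δ)) · n_{γ,δ}. -/
open Matrix
open scoped Classical

/-- The vector `n_{α,β} = (α(1−2β), (1−2α)/2, β(1−2α), (1−2β)/2) ∈ ℝ⁴`. -/
noncomputable def nvec (α β : ℝ) : Fin 4 → ℝ :=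
  ![α * (1 - 2*β), (1 - 2*α)/2, β * (1 - 2*α), (1 - 2*β)/2]

/-- The matrix `N(γ,δ)` of the return-time cocycle, built from the data `m, n ∈ ℤ`,
`r, s ∈ {1,−1}` with `f(γ) = r(γ/(1−2γ) − m)` and `f(δ) = s(δ/(1−2δ) − n)`. -/
noncomputable def Nmat (m n r s : ℤ) : Matrix (Fin 4) (Fin 4) ℝ :=
  !![2*(m:ℝ) + r, 1, 0, 2*(m:ℝ) + r;
     2*(m:ℝ), 1, 0, 2*(m:ℝ);
     0, 2*(n:ℝ) + s, 2*(n:ℝ) + s, 1;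
     0, 2*(n:ℝ), 2*(n:ℝ), 1]

theorem fmap_nonneg (t : ℝ) : 0 ≤ fmap t := by
  have h₀ := Int.fract_nonneg (t / (1 - 2*t))
  have h₁ := Int.fract_lt_one (t / (1 - 2*t))
  unfold fmap
  split_ifs <;> linarith

theorem fmap_le_half (t : ℝ) : fmap t ≤ 1/2 := by
  unfold fmap
  split_ifs with h
  · exact h
  · linarith [not_le.mp h]

/-- If `x = m + r a` is positive with `r = ±1` and `0 ≤ a ≤ 1/2`, then `m ≥ 0`, and `m ≥ 1` when
`r = -1`. -/
theorem sign_cases_of_pos {x a : ℝ} {m r : ℤ} (hx : 0 < x) (ha₀ : 0 ≤ a) (ha₁ : a ≤ 1/2)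
    (hr : r = 1 ∨ r = -1) (h : a = (r : ℝ) * (x - m)) :
    ((r : ℝ) = 1 ∧ (0 : ℝ) ≤ m ∧ x = m + a) ∨ ((r : ℝ) = -1 ∧ (1 : ℝ) ≤ m ∧ x = m - a) := by
  rcases hr with rfl | rfl <;> push_cast at h
  · have hm : (-1 : ℝ) < m := by linarith
    have hm' : (0 : ℤ) ≤ m := by
      have : (-1 : ℤ) < m := by exact_mod_cast hm
      omega
    exact Or.inl ⟨by norm_num, by exact_mod_cast hm', by linarith⟩
  · have hm : (0 : ℝ) < m := by linarith
    have hm' : (1 : ℤ) ≤ m := by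
      have : (0 : ℤ) < m := by exact_mod_cast hm
      omega
    exact Or.inr ⟨by norm_num, by exact_mod_cast hm', by linarith⟩

/-- The odd-numbered coordinates of the scaling inequality, after clearing denominators. -/
theorem scaled_coord_le {x a b m r : ℝ} (ha₀ : 0 ≤ a) (ha₁ : a ≤ 1/2) (hb₀ : 0 ≤ b)
    (h : (r = 1 ∧ 0 ≤ m ∧ x = m + a) ∨ (r = -1 ∧ 1 ≤ m ∧ x = m - a)) :
    (2*m + r) * (a * (1 - 2*b)) + 2*m * ((1 - 2*a)/2) ≤ (1 - (4/3) * (a * b)) * x := by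
  have hab := mul_nonneg ha₀ hb₀
  rcases h with ⟨rfl, hm, rfl⟩ | ⟨rfl, hm, rfl⟩
  · have : 0 ≤ (a * b) * ((8/3) * m + (2 - (4/3) * a)) := mul_nonneg hab (by linarith)
    linarith
  · have : 0 ≤ (a * b) * ((8/3) * m - (2 - (4/3) * a)) := mul_nonneg hab (by linarith)
    linarith

/-- The even-numbered coordinates of the scaling inequality, after clearing denominators. -/
theorem scaled_coord_add_half_le {x a b m r : ℝ} (ha₀ : 0 ≤ a) (ha₁ : a ≤ 1/2) (hb₀ : 0 ≤ b)
    (h : (r = 1 ∧ 0 ≤ m ∧ x = m + a) ∨ (r = -1 ∧ 1 ≤ m ∧ x = m - a)) :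
    (2*m + r) * (a * (1 - 2*b)) + 2*m * ((1 - 2*a)/2) + b * (1 - 2*a) + (1 - 2*b)/2
      ≤ (1 - (4/3) * (a * b)) * ((1 + 2*x)/2) := by
  have hab := mul_nonneg ha₀ hb₀
  have := scaled_coord_le ha₀ ha₁ hb₀ h
  linarith

/-- Scaling Lemma II. For all `γ, δ ∈ (0,1/2)` and all `m, n ∈ ℤ`,
`r, s ∈ {1,−1}` with `f(γ) = r(γ/(1−2γ) − m)` and `f(δ) = s(δ/(1−2δ) − n)`, one has the
entrywise inequality
`(1−2γ)(1−2δ)·N(γ,δ)ᵀ·n_{f(γ),f(δ)} ≤ (1 − (4/3)·f(γ)·f(δ))·n_{γ,δ}` in `ℝ⁴`. -/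
theorem scaling_lemma_II (γ δ : ℝ)
    (hγ : γ ∈ Set.Ioo (0:ℝ) (1/2)) (hδ : δ ∈ Set.Ioo (0:ℝ) (1/2))
    (m n r s : ℤ) (hr : r = 1 ∨ r = -1) (hs : s = 1 ∨ s = -1)
    (hfγ : fmap γ = (r : ℝ) * (γ / (1 - 2*γ) - m))
    (hfδ : fmap δ = (s : ℝ) * (δ / (1 - 2*δ) - n)) :
    ∀ i : Fin 4,
      (1 - 2*γ) * (1 - 2*δ) *
          ((Nmat m n r s)ᵀ.mulVec (nvec (fmap γ) (fmap δ)) i) ≤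
        (1 - (4/3) * (fmap γ * fmap δ)) * nvec γ δ i := by
  have hu : 0 < 1 - 2*γ := by linarith [hγ.2]
  have hv : 0 < 1 - 2*δ := by linarith [hδ.2]
  have hx : γ = (1 - 2*γ) * (γ / (1 - 2*γ)) := (mul_div_cancel₀ _ hu.ne').symm
  have hy : δ = (1 - 2*δ) * (δ / (1 - 2*δ)) := (mul_div_cancel₀ _ hv.ne').symm
  have hX := sign_cases_of_pos (div_pos hγ.1 hu) (fmap_nonneg γ) (fmap_le_half γ) hr hfγ
  have hY := sign_cases_of_pos (div_pos hδ.1 hv) (fmap_nonneg δ) (fmap_le_half δ) hs hfδ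
  have hx₁ := scaled_coord_le (fmap_nonneg γ) (fmap_le_half γ) (fmap_nonneg δ) hX
  have hx₂ := scaled_coord_add_half_le (fmap_nonneg γ) (fmap_le_half γ) (fmap_nonneg δ) hX
  have hy₁ := scaled_coord_le (fmap_nonneg δ) (fmap_le_half δ) (fmap_nonneg γ) hY
  have hy₂ := scaled_coord_add_half_le (fmap_nonneg δ) (fmap_le_half δ) (fmap_nonneg γ) hY
  have huv := (mul_pos hu hv).le
  generalize γ / (1 - 2*γ) = x at *
  generalize δ / (1 - 2*δ) = y at *
  generalize fmap γ = a at *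
  generalize fmap δ = b at *
  have hx' : (1 - 2*γ) * (1 + 2*x) = 1 := by linarith
  have hy' : (1 - 2*δ) * (1 + 2*y) = 1 := by linarith
  have key (w : Fin 4 → ℝ)
      (hw : nvec γ δ = ((1 - 2*γ) * (1 - 2*δ)) • w)
      (hle : ∀ i, (Nmat m n r s)ᵀ.mulVec (nvec a b) i ≤ (1 - (4/3) * (a * b)) * w i) (i : Fin 4) :
      (1 - 2*γ) * (1 - 2*δ) * ((Nmat m n r s)ᵀ.mulVec (nvec a b) i) ≤
        (1 - (4/3) * (a * b)) * nvec γ δ i := by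
    rw [hw, Pi.smul_apply, smul_eq_mul, mul_left_comm]
    exact mul_le_mul_of_nonneg_left (hle i) huv
  refine key ![x, (1 + 2*y)/2, y, (1 + 2*x)/2] ?_ ?_
  · ext i
    fin_cases i <;> simp [nvec]
    · linear_combination (1 - 2*δ) * hx
    · linear_combination -(1 - 2*γ)/2 * hy'
    · linear_combination (1 - 2*γ) * hy
    · linear_combination -(1 - 2*δ)/2 * hx'
  · intro i
    fin_cases i <;>
      simp [Nmat, nvec, Matrix.mulVec, dotProduct, Fin.sum_univ_four] <;> linarith
end

section
/- Let A = {(n,r) ∈ ℤ×{1,−1} : n ≥ 0 and (n,r) ≠ (0,−1)}, and for (n,r) ∈ A let I_{n,r} = {x ∈ [0,1/2) : r·(x/(1−2x) − n) ∈ [0,1/2]}. For every sequence (n_k, r_k)_{k≥0} of elements of A there is a unique x ∈ [0,1/2) such that the sequence of iterates x₀ = x, x_{k+1} = f(x_k) is defined for all k (i.e. each x_k lies in [0,1/2)) and x_k ∈ I_{n_k,r_k} for every k ≥ 0. Moreover, the map from A^ℕ (with the product topology, A discrete) to [0,1/2) sending a sequence to this x is continuous, and x is irrational unless there exists K such that (n_k,r_k)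 = (0,1) for all k ≥ K. -/
open scoped Classical

/-- The alphabet `A = {(n,r) ∈ ℤ × {1,−1} : n ≥ 0, (n,r) ≠ (0,−1)}`, with the discrete
topology (as a subset of `ℤ × ℤ`). -/
def Aset : Set (ℤ × ℤ) :=
  {p | 0 ≤ p.1 ∧ (p.2 = 1 ∨ p.2 = -1) ∧ p ≠ (0, -1)}

/-- The interval `I_{n,r} = {x ∈ [0,1/2) : r(x/(1−2x) − n) ∈ [0,1/2]}`, for
`(n,r) ∈ A`. -/
def Iset (p : ℤ × ℤ) : Set ℝ :=
  {x | x ∈ Set.Ico (0:ℝ) (1/2) ∧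
    (p.2 : ℝ) * (x / (1 - 2*x) - (p.1 : ℝ)) ∈ Set.Icc (0:ℝ) (1/2)}

open Filter Topology

/-- The inverse branch of `fmap` on `Iset p`. -/
noncomputable def branch (p : ℤ × ℤ) (y : ℝ) : ℝ :=
  (p.1 + p.2 * y) / (1 + 2 * (p.1 + p.2 * y))

/-- The sequence `u` with its first letter removed. -/
def shift (u : ℕ → Aset) : ℕ → Aset := fun k => u (k + 1)

/-- The inverse branches given by the first `k` letters of `u`, applied to `0`. -/
noncomputable def approx : ℕ → (ℕ → Aset) → ℝ
  | 0, _ => 0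
  | k + 1, u => branch (u 0) (approx k (shift u))

lemma add_mul_nonneg_of_mem_Aset {p : ℤ × ℤ} (hp : p ∈ Aset) {y : ℝ}
    (hy : y ∈ Set.Icc (0 : ℝ) (1 / 2)) : 0 ≤ (p.1 + p.2 * y : ℝ) := by
  obtain ⟨n, r⟩ := p
  obtain ⟨hn, hr, hne⟩ := hp
  obtain ⟨hy0, hy1⟩ := hy
  dsimp only at hn hr ⊢
  rcases hr with rfl | rfl
  · have : (0 : ℝ) ≤ n := by exact_mod_cast hn
    push_cast
    linarith
  · have h : n ≠ 0 := fun h => hne (by rw [h])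
    have : (1 : ℝ) ≤ n := by exact_mod_cast (show 1 ≤ n by omega)
    push_cast
    linarith

lemma sq_eq_one_of_mem_Aset {p : ℤ × ℤ} (hp : p ∈ Aset) : (p.2 * p.2 : ℝ) = 1 := by
  rcases hp.2.1 with h | h <;> simp [h]

lemma fmap_eq_of_mem_Iset {p : ℤ × ℤ} (hp : p ∈ Aset) {x : ℝ} (hx : x ∈ Iset p) :
    fmap x = p.2 * (x / (1 - 2 * x) - p.1) := by
  obtain ⟨n, r⟩ := p
  obtain ⟨-, hr, -⟩ := hp
  obtain ⟨-, h0, h1⟩ := hx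
  unfold fmap
  dsimp only at hr h0 h1 ⊢
  generalize x / (1 - 2 * x) = t at *
  rcases hr with rfl | rfl <;> push_cast at h0 h1 ⊢
  · have hfl : ⌊t⌋ = n := Int.floor_eq_iff.2 ⟨by linarith, by linarith⟩
    have hfr : Int.fract t = t - n := by rw [← Int.self_sub_floor, hfl]
    rw [hfr, if_pos (by linarith)]
    ring
  · rcases eq_or_lt_of_le h0 with h | h
    · have ht : t = n := by linarith
      simp [ht]
    · have hfl : ⌊t⌋ = n - 1 :=
        Int.floor_eq_iff.2 ⟨by push_cast; linarith, by push_cast; linarith⟩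
      have hfr : Int.fract t = t - n + 1 := by
        rw [← Int.self_sub_floor, hfl]
        push_cast
        ring
      rw [hfr]
      split_ifs <;> linarith

lemma fmap_mem_Icc {p : ℤ × ℤ} (hp : p ∈ Aset) {x : ℝ} (hx : x ∈ Iset p) :
    fmap x ∈ Set.Icc (0 : ℝ) (1 / 2) := by
  rw [fmap_eq_of_mem_Iset hp hx]
  exact hx.2

lemma branch_fmap {p : ℤ × ℤ} (hp : p ∈ Aset) {x : ℝ} (hx : x ∈ Iset p) :
    branch p (fmap x) = x := by
  have hs : (p.1 + p.2 * fmap x : ℝ) = x / (1 - 2 * x) := by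
    rw [fmap_eq_of_mem_Iset hp hx, ← mul_assoc, sq_eq_one_of_mem_Aset hp]
    ring
  have h1 : 1 - 2 * x ≠ 0 := by linarith [hx.1.2]
  have h2 : 1 + 2 * (x / (1 - 2 * x)) = 1 / (1 - 2 * x) := by
    field_simp
    ring
  rw [branch, hs, h2, div_div_div_cancel_right₀ h1, div_one]

lemma branch_mem_Iset {p : ℤ × ℤ} (hp : p ∈ Aset) {y : ℝ}
    (hy : y ∈ Set.Icc (0 : ℝ) (1 / 2)) : branch p y ∈ Iset p ∧ fmap (branch p y) = y := by
  have hs := add_mul_nonneg_of_mem_Aset hp hy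
  have hinv : branch p y / (1 - 2 * branch p y) = p.1 + p.2 * y := by
    unfold branch
    generalize (p.1 + p.2 * y : ℝ) = s at *
    have h1 : 1 + 2 * s ≠ 0 := by positivity
    have h2 : 1 - 2 * (s / (1 + 2 * s)) = 1 / (1 + 2 * s) := by
      field_simp
      ring
    rw [h2]
    field_simp
  have hval : (p.2 * (branch p y / (1 - 2 * branch p y) - p.1) : ℝ) = y := by
    rw [hinv]
    linear_combination y * sq_eq_one_of_mem_Aset hp
  have hmem : branch p y ∈ Iset p := by
    refine ⟨⟨by unfold branch; positivity, ?_⟩, by rwa [hval]⟩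
    rw [branch, div_lt_div_iff₀ (by positivity) (by positivity)]
    linarith
  exact ⟨hmem, by rw [fmap_eq_of_mem_Iset hp hmem, hval]⟩

lemma Iset_subset_Icc (p : ℤ × ℤ) : Iset p ⊆ Set.Icc (0 : ℝ) (1 / 2) :=
  fun _ hx => ⟨hx.1.1, hx.1.2.le⟩

lemma abs_div_sub_div_le {s t c : ℝ} (hs : 0 ≤ s) (ht : 0 ≤ t) (hc : 0 < c)
    (h : |s - t| ≤ 1 / c) : |s / (1 + 2 * s) - t / (1 + 2 * t)| ≤ 1 / (c + 2) := by
  have heq : s / (1 + 2 * s) - t / (1 + 2 * t) = (s - t) / ((1 + 2 * s) * (1 + 2 * t)) := by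
    field_simp
    ring
  have hst : |s - t| ≤ s + t := abs_le.2 ⟨by linarith, by linarith⟩
  rw [le_div_iff₀ hc] at h
  rw [heq, abs_div, abs_of_pos (show 0 < (1 + 2 * s) * (1 + 2 * t) by positivity),
    div_le_div_iff₀ (by positivity) (by positivity)]
  nlinarith [mul_nonneg hs ht]

lemma abs_branch_sub_le {p : ℤ × ℤ} (hp : p ∈ Aset) {y z : ℝ}
    (hy : y ∈ Set.Icc (0 : ℝ) (1 / 2)) (hz : z ∈ Set.Icc (0 : ℝ) (1 / 2)) {k : ℕ}
    (h : |y - z| ≤ 1 / (2 * k + 2)) :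
    |branch p y - branch p z| ≤ 1 / (2 * (k + 1 : ℕ) + 2) := by
  have hr : |(p.2 : ℝ)| = 1 := by rcases hp.2.1 with h | h <;> simp [h]
  have hd : |(p.1 + p.2 * y : ℝ) - (p.1 + p.2 * z)| ≤ 1 / (2 * k + 2) := by
    rwa [add_sub_add_left_eq_sub, ← mul_sub, abs_mul, hr, one_mul]
  rw [show (2 * (k + 1 : ℕ) + 2 : ℝ) = 2 * k + 2 + 2 by push_cast; ring]
  exact abs_div_sub_div_le (add_mul_nonneg_of_mem_Aset hp hy)
    (add_mul_nonneg_of_mem_Aset hp hz) (by positivity) hd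

lemma approx_mem_Icc (k : ℕ) (u : ℕ → Aset) : approx k u ∈ Set.Icc (0 : ℝ) (1 / 2) := by
  induction k generalizing u with
  | zero => simp [approx]
  | succ k ih => exact Iset_subset_Icc _ (branch_mem_Iset (u 0).2 (ih _)).1

lemma abs_sub_le_half {y z : ℝ} (hy : y ∈ Set.Icc (0 : ℝ) (1 / 2))
    (hz : z ∈ Set.Icc (0 : ℝ) (1 / 2)) : |y - z| ≤ 1 / 2 :=
  abs_le.2 ⟨by linarith [hy.1, hz.2], by linarith [hy.2, hz.1]⟩

lemma abs_approx_sub_approx_le (k m : ℕ) (h : k ≤ m) (u : ℕ → Aset) :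
    |approx k u - approx m u| ≤ 1 / (2 * k + 2) := by
  induction k generalizing u m with
  | zero => simpa using abs_sub_le_half (approx_mem_Icc 0 u) (approx_mem_Icc m u)
  | succ k ih =>
    obtain ⟨m, rfl⟩ := Nat.exists_eq_succ_of_ne_zero (by omega : m ≠ 0)
    exact abs_branch_sub_le (u 0).2 (approx_mem_Icc _ _) (approx_mem_Icc _ _)
      (ih m (by omega) _)

lemma abs_approx_sub_le_of_forall_mem_Iset (k : ℕ) (u : ℕ → Aset) (x : ℝ)
    (hx : ∀ k, fmap^[k] x ∈ Iset (u k)) : |approx k u - x| ≤ 1 / (2 * k + 2) := by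
  have h0 : x ∈ Iset (u 0) := hx 0
  induction k generalizing u x with
  | zero => simpa using abs_sub_le_half (approx_mem_Icc 0 u) (Iset_subset_Icc _ h0)
  | succ k ih =>
    have hs : ∀ k, fmap^[k] (fmap x) ∈ Iset (shift u k) := fun k => hx (k + 1)
    have := abs_branch_sub_le (u 0).2 (approx_mem_Icc _ _) (fmap_mem_Icc (u 0).2 h0)
      (ih (shift u) (fmap x) hs (hs 0))
    rwa [branch_fmap (u 0).2 h0] at this

lemma tendsto_one_div_two_mul_add_two :
    Tendsto (fun k : ℕ => (1 : ℝ) / (2 * k + 2)) atTop (𝓝 0) := by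
  have h := (tendsto_one_div_add_atTop_nhds_zero_nat (𝕜 := ℝ)).const_mul (1 / 2)
  rw [mul_zero] at h
  refine h.congr fun k => ?_
  field_simp

lemma continuous_approx (k : ℕ) : Continuous (approx k) := by
  induction k with
  | zero => exact continuous_const
  | succ k ih =>
    have hshift : Continuous shift := continuous_pi fun k => continuous_apply (k + 1)
    have h1 : Continuous fun u : ℕ → Aset => (((u 0 : ℤ × ℤ).1 : ℤ) : ℝ) :=
      continuous_of_discreteTopology.comp
        (continuous_fst.comp (continuous_subtype_val.comp (continuous_apply 0)))
    have h2 : Continuous fun u : ℕ → Aset => (((u 0 : ℤ × ℤ).2 : ℤ) : ℝ) :=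
      continuous_of_discreteTopology.comp
        (continuous_snd.comp (continuous_subtype_val.comp (continuous_apply 0)))
    have hs := h1.add (h2.mul (ih.comp hshift))
    refine hs.div (continuous_const.add (continuous_const.mul hs)) fun u => ?_
    have := add_mul_nonneg_of_mem_Aset (u 0).2 (approx_mem_Icc k (shift u))
    exact (add_pos_of_pos_of_nonneg one_pos (mul_nonneg two_pos.le this)).ne'

lemma exists_tendsto_approx (u : ℕ → Aset) :
    ∃ x, Tendsto (fun k => approx k u) atTop (𝓝 x) := by
  refine cauchySeq_tendsto_of_complete (cauchySeq_of_le_tendsto_0'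
    (fun k : ℕ => (1 : ℝ) / (2 * k + 2)) (fun k m h => ?_) tendsto_one_div_two_mul_add_two)
  rw [Real.dist_eq]
  exact abs_approx_sub_approx_le k m h u

/-- The point coded by the sequence `u`. -/
noncomputable def codedPoint (u : ℕ → Aset) : ℝ := (exists_tendsto_approx u).choose

lemma tendsto_approx (u : ℕ → Aset) :
    Tendsto (fun k => approx k u) atTop (𝓝 (codedPoint u)) :=
  (exists_tendsto_approx u).choose_spec

lemma abs_approx_sub_codedPoint_le (k : ℕ) (u : ℕ → Aset) :
    |approx k u - codedPoint u| ≤ 1 / (2 * k + 2) :=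
  le_of_tendsto ((tendsto_const_nhds.sub (tendsto_approx u)).abs)
    (eventually_atTop.2 ⟨k, fun m h => abs_approx_sub_approx_le k m h u⟩)

lemma codedPoint_mem_Icc (u : ℕ → Aset) : codedPoint u ∈ Set.Icc (0 : ℝ) (1 / 2) :=
  isClosed_Icc.mem_of_tendsto (tendsto_approx u) (Eventually.of_forall fun k => approx_mem_Icc k u)

lemma continuous_codedPoint : Continuous codedPoint := by
  have h : TendstoUniformly approx codedPoint atTop := by
    refine Metric.tendstoUniformly_iff.2 fun ε hε => ?_
    filter_upwards [tendsto_one_div_two_mul_add_two.eventually_lt_const hε] with k hk u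
    rw [dist_comm, Real.dist_eq]
    exact (abs_approx_sub_codedPoint_le k u).trans_lt hk
  exact h.continuous (Eventually.of_forall continuous_approx).frequently

lemma codedPoint_eq_branch (u : ℕ → Aset) :
    codedPoint u = branch (u 0) (codedPoint (shift u)) := by
  have hs := ((tendsto_approx (shift u)).const_mul (((u 0 : ℤ × ℤ).2 : ℤ) : ℝ)).const_add
    (((u 0 : ℤ × ℤ).1 : ℤ) : ℝ)
  have hpos := add_mul_nonneg_of_mem_Aset (u 0).2 (codedPoint_mem_Icc (shift u))
  exact tendsto_nhds_unique ((tendsto_approx u).comp (tendsto_add_atTop_nat 1))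
    (hs.div ((hs.const_mul 2).const_add 1) (by positivity))

lemma iterate_fmap_codedPoint_mem_Iset (k : ℕ) (u : ℕ → Aset) :
    fmap^[k] (codedPoint u) ∈ Iset (u k) := by
  have h := branch_mem_Iset (u 0).2 (codedPoint_mem_Icc (shift u))
  rw [← codedPoint_eq_branch] at h
  induction k generalizing u with
  | zero => exact h.1
  | succ k ih =>
    rw [Function.iterate_succ_apply, h.2]
    refine ih (shift u) ?_
    have h' := branch_mem_Iset (shift u 0).2 (codedPoint_mem_Icc (shift (shift u)))
    rwa [← codedPoint_eq_branch] at h'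

lemma eq_codedPoint_of_forall_mem_Iset (u : ℕ → Aset) (x : ℝ)
    (hx : ∀ k, fmap^[k] x ∈ Iset (u k)) : x = codedPoint u := by
  refine tendsto_nhds_unique (tendsto_iff_dist_tendsto_zero.2 ?_) (tendsto_approx u)
  exact squeeze_zero (fun _ => dist_nonneg)
    (fun k => abs_approx_sub_le_of_forall_mem_Iset k u x hx) tendsto_one_div_two_mul_add_two

lemma eq_of_zero_mem_Iset {p : ℤ × ℤ} (hp : p ∈ Aset) (h : (0 : ℝ) ∈ Iset p) : p = (0, 1) := by
  obtain ⟨n, r⟩ := p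
  obtain ⟨hn, hr, hne⟩ := hp
  obtain ⟨-, h0, h1⟩ := h
  dsimp only at hn hr h0 h1
  rcases hr with rfl | rfl <;> push_cast at h0 h1
  · have : (n : ℝ) ≤ 0 := by linarith
    have : n ≤ 0 := by exact_mod_cast this
    rw [le_antisymm this hn]
  · have : (n : ℝ) < 1 := by linarith
    have : n < 1 := by exact_mod_cast this
    exact absurd (by rw [show n = 0 by omega]) hne

lemma fmap_zero : fmap 0 = 0 := by simp [fmap]

lemma eventually_eq_of_rational (b : ℕ) (hb : 0 < b) (a : ℤ) (u : ℕ → Aset)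
    (hx : ∀ k, fmap^[k] (a / b : ℝ) ∈ Iset (u k)) :
    ∃ K : ℕ, ∀ k ≥ K, (u k : ℤ × ℤ) = (0, 1) := by
  induction b using Nat.strong_induction_on generalizing a u with
  | _ b ih =>
  have hbR : (0 : ℝ) < b := by exact_mod_cast hb
  have h0 : (a / b : ℝ) ∈ Iset (u 0) := hx 0
  have ha : 0 ≤ a := by
    have := h0.1.1
    rw [le_div_iff₀ hbR, zero_mul] at this
    exact_mod_cast this
  have hab : 2 * a < b := by
    have := h0.1.2
    rw [div_lt_div_iff₀ hbR two_pos] at this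
    have : (2 * a : ℝ) < b := by linarith
    exact_mod_cast this
  rcases ha.eq_or_lt with rfl | ha
  · refine ⟨0, fun k _ => eq_of_zero_mem_Iset (u k).2 ?_⟩
    have := hx k
    rwa [Int.cast_zero, zero_div, Function.iterate_fixed fmap_zero] at this
  · obtain ⟨c, hc⟩ := Int.eq_ofNat_of_zero_le (show 0 ≤ (b : ℤ) - 2 * a by omega)
    have hcR : (b - 2 * a : ℝ) = c := by exact_mod_cast hc
    have hc0 : (0 : ℝ) < c := by exact_mod_cast (show 0 < c by omega)
    have hf : fmap (a / b : ℝ) =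
        (((u 0 : ℤ × ℤ).2 * (a - (u 0 : ℤ × ℤ).1 * c) : ℤ) : ℝ) / (c : ℝ) := by
      have h1 : (1 - 2 * (a / b) : ℝ) = c / b := by
        rw [← hcR]
        field_simp
      rw [fmap_eq_of_mem_Iset (u 0).2 h0, h1]
      push_cast
      field_simp
    obtain ⟨K, hK⟩ := ih c (by omega) (by omega) _ (shift u) fun k => by
      rw [← hf]
      exact hx (k + 1)
    refine ⟨K + 1, fun k hk => ?_⟩
    obtain ⟨k, rfl⟩ := Nat.exists_eq_succ_of_ne_zero (by omega : k ≠ 0)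
    exact hK k (by omega)

lemma irrational_codedPoint (u : ℕ → Aset)
    (hu : ¬ ∃ K : ℕ, ∀ k ≥ K, (u k : ℤ × ℤ) = (0, 1)) : Irrational (codedPoint u) := by
  rintro ⟨q, hq⟩
  refine hu (eventually_eq_of_rational q.den q.den_pos q.num u fun k => ?_)
  rw [← Rat.cast_def, hq]
  exact iterate_fmap_codedPoint_mem_Iset k u

/-- Coding Theorem 9.1. For every sequence `(n_k,r_k)_{k≥0}` in `A`
there is a unique `x ∈ [0,1/2)` whose `f`-orbit is defined for all times and satisfies
`f^k(x) ∈ I_{n_k,r_k}` for all `k ≥ 0`; this `x` depends continuously on the sequence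
(with the product topology on `A^ℕ`), and `x` is irrational unless the sequence is
eventually constant equal to `(0,1)`. -/
theorem coding_theorem :
    ∃ g : (ℕ → Aset) → ℝ, Continuous g ∧
      ∀ u : ℕ → Aset,
        ((∀ k : ℕ, fmap^[k] (g u) ∈ Iset (u k)) ∧
          (∀ x : ℝ, (∀ k : ℕ, fmap^[k] x ∈ Iset (u k)) → x = g u)) ∧
        ((¬ ∃ K : ℕ, ∀ k ≥ K, (u k : ℤ × ℤ) = (0, 1)) → Irrational (g u)) := by
  exact ⟨codedPoint, continuous_codedPoint, fun u =>
    ⟨⟨fun k => iterate_fmap_codedPoint_mem_Iset k u, eq_codedPoint_of_forall_mem_Iset u⟩,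
      irrational_codedPoint u⟩⟩
end

section
/- Let I be the set of irrational numbers in (0,1/2); the map f restricts to a map I → I. Let m be the Borel measure on I with density x ↦ 1/x + 1/(1−x) with respect to Lebesgue measure, i.e. m(A) = ∫_A (1/x + 1/(1−x)) dx. Then m is f-invariant: m(f⁻¹(A)) = m(A) for every Borel A ⊆ I. -/
open MeasureTheory
open scoped Classical

/-- `I`: the set of irrational numbers in `(0,1/2)`. -/
def Iirr : Set ℝ := {x | x ∈ Set.Ioo (0:ℝ) (1/2) ∧ Irrational x}

/-- The measure `m` on `I` with density `x ↦ 1/x + 1/(1−x)` with respect to Lebesgue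
measure. -/
noncomputable def mGauss : Measure ℝ :=
  (volume.restrict Iirr).withDensity (fun x => ENNReal.ofReal (1/x + 1/(1-x)))

open Filter Topology in
/-- Telescoping series with terms `1/(n+y) - 1/(n+y+1)`, in `ℝ≥0∞`. -/
theorem tsum_ofReal_one_div_sub_one_div {y : ℝ} (hy : 0 < y) :
    ∑' n : ℕ, ENNReal.ofReal (1 / (n + y) - 1 / (n + y + 1)) = ENNReal.ofReal (1 / y) := by
  have hnn (n : ℕ) : 0 ≤ 1 / ((n : ℝ) + y) - 1 / (n + y + 1) :=
    sub_nonneg.2 (one_div_le_one_div_of_le (by positivity) (by linarith))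
  have hs : HasSum (fun n : ℕ => 1 / ((n : ℝ) + y) - 1 / (n + y + 1)) (1 / y) := by
    rw [hasSum_iff_tendsto_nat_of_nonneg hnn]
    have hsum (N : ℕ) : ∑ n ∈ Finset.range N, (1 / ((n : ℝ) + y) - 1 / (n + y + 1))
        = 1 / y - 1 / (N + y) := by
      have h := Finset.sum_range_sub' (fun n : ℕ => 1 / ((n : ℝ) + y)) N
      simp only [Nat.cast_zero, zero_add] at h
      rw [← h]
      refine Finset.sum_congr rfl fun n _ => ?_
      push_cast
      ring
    simp only [hsum]
    have h : Tendsto (fun N : ℕ => 1 / ((N : ℝ) + y)) atTop (𝓝 0) := by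
      simp only [one_div]
      exact tendsto_inv_atTop_zero.comp
        (tendsto_atTop_add_const_right _ _ tendsto_natCast_atTop_atTop)
    simpa using h.const_sub (1 / y)
  rw [← ENNReal.ofReal_tsum_of_nonneg hnn hs.summable, hs.tsum_eq]

/-- The branch `y ↦ s/(1+2s)`, `s = c + e y`, of the inverse of `fmap`. -/
noncomputable def fmapBranch (c e y : ℝ) : ℝ := (c + e * y) / (1 + 2 * (c + e * y))

theorem fmapBranch_div {c e y : ℝ} (h : 0 < c + e * y) :
    fmapBranch c e y / (1 - 2 * fmapBranch c e y) = c + e * y := by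
  have h2 : 1 - 2 * fmapBranch c e y = 1 / (1 + 2 * (c + e * y)) := by
    unfold fmapBranch
    field_simp
    ring
  rw [h2, fmapBranch]
  field_simp

theorem fmapBranch_mem_Ioo {c e y : ℝ} (h : 0 < c + e * y) :
    fmapBranch c e y ∈ Set.Ioo (0 : ℝ) (1 / 2) := by
  refine ⟨by unfold fmapBranch; positivity, ?_⟩
  unfold fmapBranch
  rw [div_lt_div_iff₀ (by positivity) (by norm_num)]
  linarith

theorem one_add_two_mul_div {x : ℝ} (hx : x < 1 / 2) :
    1 + 2 * (x / (1 - 2 * x)) = 1 / (1 - 2 * x) := by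
  have h0 : 1 - 2 * x ≠ 0 := by linarith
  field_simp
  ring

theorem eq_fmapBranch {c e y x : ℝ} (hx : x ∈ Set.Ioo (0 : ℝ) (1 / 2))
    (h : x / (1 - 2 * x) = c + e * y) : x = fmapBranch c e y := by
  have h0 : 0 < 1 - 2 * x := by linarith [hx.2]
  rw [fmapBranch, ← h, one_add_two_mul_div hx.2, div_div_div_cancel_right₀ h0.ne', div_one]

theorem hasDerivAt_fmapBranch {c e y : ℝ} (h : 0 < c + e * y) :
    HasDerivAt (fmapBranch c e) (e / (1 + 2 * (c + e * y)) ^ 2) y := by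
  have h1 : HasDerivAt (fun y => c + e * y) e y := by
    simpa using ((hasDerivAt_id y).const_mul e).const_add c
  have h2 : HasDerivAt (fun y => 1 + 2 * (c + e * y)) (2 * e) y :=
    (h1.const_mul 2).const_add 1
  refine (h1.div h2 (by positivity)).congr_deriv ?_
  ring

theorem injOn_fmapBranch {A : Set ℝ} {c e : ℝ} (he : |e| = 1) (h : ∀ y ∈ A, 0 < c + e * y) :
    Set.InjOn (fmapBranch c e) A := by
  intro y hy z hz hyz
  have h1 := fmapBranch_div (h y hy)
  rw [hyz, fmapBranch_div (h z hz)] at h1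
  have he0 : e ≠ 0 := by rintro rfl; simp at he
  exact (mul_left_cancel₀ he0 (add_left_cancel h1)).symm

theorem measurableSet_image_fmapBranch {A : Set ℝ} (hA : MeasurableSet A) {c e : ℝ}
    (he : |e| = 1) (h : ∀ y ∈ A, 0 < c + e * y) : MeasurableSet (fmapBranch c e '' A) :=
  hA.image_of_continuousOn_injOn
    (fun y hy => (hasDerivAt_fmapBranch (h y hy)).continuousAt.continuousWithinAt)
    (injOn_fmapBranch he h)

theorem setLIntegral_image_fmapBranch {A : Set ℝ} (hA : MeasurableSet A) {c e : ℝ}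
    (he : |e| = 1) (h : ∀ y ∈ A, 0 < c + e * y) :
    ∫⁻ x in fmapBranch c e '' A, ENNReal.ofReal (1 / x + 1 / (1 - x))
      = ∫⁻ y in A, ENNReal.ofReal (1 / (c + e * y) - 1 / (c + e * y + 1)) := by
  rw [lintegral_image_eq_lintegral_abs_deriv_mul hA
    (fun y hy => (hasDerivAt_fmapBranch (h y hy)).hasDerivWithinAt) (injOn_fmapBranch he h)]
  refine setLIntegral_congr_fun hA fun y hy => ?_
  have hs := h y hy
  rw [← ENNReal.ofReal_mul (abs_nonneg _), abs_div, he, abs_of_pos (by positivity), fmapBranch]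
  generalize c + e * y = s at hs
  have h1 : 1 - s / (1 + 2 * s) = (1 + s) / (1 + 2 * s) := by
    field_simp
    ring
  rw [h1]
  congr 1
  field_simp
  ring

theorem irrational_div_one_sub_two_mul_iff {x : ℝ} (hx : x ∈ Set.Ioo (0 : ℝ) (1 / 2)) :
    Irrational (x / (1 - 2 * x)) ↔ Irrational x := by
  have h0 : 0 < 1 - 2 * x := by linarith [hx.2]
  refine ⟨?_, ?_⟩ <;> contrapose <;> simp only [Irrational, not_not] <;> rintro ⟨q, hq⟩
  · exact ⟨q / (1 - 2 * q), by push_cast; rw [hq]⟩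
  · refine ⟨q / (1 + 2 * q), ?_⟩
    push_cast
    rw [hq, one_add_two_mul_div hx.2, div_div_div_cancel_right₀ h0.ne', div_one]

theorem irrational_fmap_iff {x : ℝ} (hx : x ∈ Set.Ioo (0 : ℝ) (1 / 2)) :
    Irrational (fmap x) ↔ Irrational x := by
  rw [← irrational_div_one_sub_two_mul_iff hx, fmap, Int.fract]
  split_ifs
  · rw [irrational_sub_intCast_iff]
  · have h : 1 - (x / (1 - 2 * x) - ⌊x / (1 - 2 * x)⌋)
      = ((1 + ⌊x / (1 - 2 * x)⌋ : ℤ) : ℝ) - x / (1 - 2 * x) := by push_cast; ring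
    rw [h, irrational_intCast_sub_iff]

theorem fmap_mem_Iirr {x : ℝ} (hx : x ∈ Iirr) : fmap x ∈ Iirr := by
  have hirr := (irrational_fmap_iff hx.1).2 hx.2
  have h0 : fmap x ≠ 0 := hirr.ne_zero
  have h1 : fmap x ≠ 1 / 2 := fun h => hirr ⟨1 / 2, by rw [h]; norm_num⟩
  refine ⟨⟨lt_of_le_of_ne ?_ h0.symm, lt_of_le_of_ne ?_ h1⟩, hirr⟩ <;> unfold fmap <;>
    split_ifs <;>
    linarith [Int.fract_nonneg (x / (1 - 2 * x)), Int.fract_lt_one (x / (1 - 2 * x))]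

theorem fmap_of_eq_add {x y : ℝ} {n : ℕ} (hy : y ∈ Set.Ioo (0 : ℝ) (1 / 2))
    (h : x / (1 - 2 * x) = n + 1 * y) : fmap x = y := by
  have hf : Int.fract (x / (1 - 2 * x)) = y := by
    rw [h, one_mul, Int.fract_natCast_add, Int.fract_eq_self]
    exact ⟨hy.1.le, by linarith [hy.2]⟩
  rw [fmap, hf, if_pos hy.2.le]

theorem fmap_of_eq_sub {x y : ℝ} {n : ℕ} (hy : y ∈ Set.Ioo (0 : ℝ) (1 / 2))
    (h : x / (1 - 2 * x) = (n + 1) + (-1) * y) : fmap x = y := by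
  have hf : Int.fract (x / (1 - 2 * x)) = 1 - y := by
    rw [h, show ((n : ℝ) + 1) + (-1) * y = n + (1 - y) by ring, Int.fract_natCast_add,
      Int.fract_eq_self]
    exact ⟨by linarith [hy.2], by linarith [hy.1]⟩
  rw [fmap, hf, if_neg (by linarith [hy.2])]
  ring

theorem preimage_fmap_inter_Iirr {A : Set ℝ} (hA : A ⊆ Iirr) :
    fmap ⁻¹' A ∩ Iirr = (⋃ n : ℕ, fmapBranch n 1 '' A) ∪
      ⋃ n : ℕ, fmapBranch (n + 1) (-1) '' A := by
  ext x
  simp only [Set.mem_inter_iff, Set.mem_preimage, Set.mem_union, Set.mem_iUnion, Set.mem_image]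
  constructor
  · rintro ⟨hxA, hx⟩
    have hpos : 0 ≤ x / (1 - 2 * x) := div_nonneg hx.1.1.le (by linarith [hx.1.2])
    have hfl : ((⌊x / (1 - 2 * x)⌋₊ : ℕ) : ℝ) = ⌊x / (1 - 2 * x)⌋ :=
      natCast_floor_eq_intCast_floor hpos
    have hfr := Int.floor_add_fract (x / (1 - 2 * x))
    by_cases h : Int.fract (x / (1 - 2 * x)) ≤ 1 / 2
    · refine Or.inl ⟨⌊x / (1 - 2 * x)⌋₊, fmap x, hxA, (eq_fmapBranch hx.1 ?_).symm⟩
      rw [fmap, if_pos h, hfl]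
      linarith
    · refine Or.inr ⟨⌊x / (1 - 2 * x)⌋₊, fmap x, hxA, (eq_fmapBranch hx.1 ?_).symm⟩
      rw [fmap, if_neg h, hfl]
      linarith
  · rintro (⟨n, y, hy, rfl⟩ | ⟨n, y, hy, rfl⟩)
    · have hy' := (hA hy).1
      have hs : 0 < (n : ℝ) + 1 * y := by linarith [hy'.1, n.cast_nonneg (α := ℝ)]
      have hf := fmap_of_eq_add hy' (fmapBranch_div hs)
      have hI := fmapBranch_mem_Ioo hs
      refine ⟨by rwa [hf], hI, (irrational_fmap_iff hI).1 ?_⟩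
      rw [hf]
      exact (hA hy).2
    · have hy' := (hA hy).1
      have hs : 0 < (n + 1 : ℝ) + (-1) * y := by linarith [hy'.2, n.cast_nonneg (α := ℝ)]
      have hf := fmap_of_eq_sub hy' (fmapBranch_div hs)
      have hI := fmapBranch_mem_Ioo hs
      refine ⟨by rwa [hf], hI, (irrational_fmap_iff hI).1 ?_⟩
      rw [hf]
      exact (hA hy).2

theorem mGauss_apply_of_subset {B : Set ℝ} (hB : MeasurableSet B) (h : B ⊆ Iirr) :
    mGauss B = ∫⁻ x in B, ENNReal.ofReal (1 / x + 1 / (1 - x)) := by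
  rw [mGauss, withDensity_apply _ hB, Measure.restrict_restrict hB,
    Set.inter_eq_left.2 h]

theorem measurableSet_Iirr : MeasurableSet Iirr :=
  measurableSet_Ioo.inter (Set.countable_range _).measurableSet.compl

theorem mGauss_apply_inter_Iirr (B : Set ℝ) : mGauss (B ∩ Iirr) = mGauss B := by
  refine measure_inter_conull ?_
  have hac : mGauss ≪ volume.restrict Iirr := withDensity_absolutelyContinuous _ _
  refine hac ?_
  rw [Measure.restrict_apply measurableSet_Iirr.compl, Set.compl_inter_self, measure_empty]

/-- Invariant measure, §9.2. The map `f` restricts to a map `I → I`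
of the irrationals of `(0,1/2)`, and the measure `m` with density `1/x + 1/(1−x)` is
`f`-invariant: `m(f⁻¹(A)) = m(A)` for every Borel `A ⊆ I`. -/
theorem fmap_invariant_measure :
    (∀ x ∈ Iirr, fmap x ∈ Iirr) ∧
    (∀ A : Set ℝ, A ⊆ Iirr → MeasurableSet A → mGauss (fmap ⁻¹' A) = mGauss A) := by
  refine ⟨fun x hx => fmap_mem_Iirr hx, fun A hA hAm => ?_⟩
  have hA' (y : ℝ) (hy : y ∈ A) : y ∈ Set.Ioo (0 : ℝ) (1 / 2) := (hA hy).1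
  have hg (n : ℕ) : ∀ y ∈ A, 0 < (n : ℝ) + 1 * y := fun y hy => by
    linarith [(hA' y hy).1, n.cast_nonneg (α := ℝ)]
  have hh (n : ℕ) : ∀ y ∈ A, 0 < (n + 1 : ℝ) + (-1) * y := fun y hy => by
    linarith [(hA' y hy).2, n.cast_nonneg (α := ℝ)]
  have hgm (n : ℕ) := measurableSet_image_fmapBranch hAm abs_one (hg n)
  have hhm (n : ℕ) := measurableSet_image_fmapBranch hAm (by simp) (hh n)
  have hgd : Pairwise (Function.onFun Disjoint fun n : ℕ => fmapBranch n 1 '' A) := by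
    intro n m hnm
    rw [Function.onFun, Set.disjoint_left]
    rintro _ ⟨y, hy, rfl⟩ ⟨z, hz, hzy⟩
    have hf := fmap_of_eq_add (hA' y hy) (fmapBranch_div (hg n y hy))
    have hyz : z = y := by
      rw [← hf, ← hzy, fmap_of_eq_add (hA' z hz) (fmapBranch_div (hg m z hz))]
    have h := fmapBranch_div (hg n y hy)
    rw [← hzy, fmapBranch_div (hg m z hz), hyz] at h
    exact hnm (by exact_mod_cast (add_right_cancel h).symm)
  have hhd : Pairwise (Function.onFun Disjoint fun n : ℕ => fmapBranch (n + 1) (-1) '' A) := by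
    intro n m hnm
    rw [Function.onFun, Set.disjoint_left]
    rintro _ ⟨y, hy, rfl⟩ ⟨z, hz, hzy⟩
    have hf := fmap_of_eq_sub (hA' y hy) (fmapBranch_div (hh n y hy))
    have hyz : z = y := by
      rw [← hf, ← hzy, fmap_of_eq_sub (hA' z hz) (fmapBranch_div (hh m z hz))]
    have h := fmapBranch_div (hh n y hy)
    rw [← hzy, fmapBranch_div (hh m z hz), hyz] at h
    exact hnm (by exact_mod_cast (add_right_cancel (add_right_cancel h)).symm)
  have hd : Disjoint (⋃ n : ℕ, fmapBranch n 1 '' A) (⋃ n : ℕ, fmapBranch (n + 1) (-1) '' A) := by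
    simp only [Set.disjoint_iUnion_left, Set.disjoint_iUnion_right]
    intro m n
    rw [Set.disjoint_left]
    rintro _ ⟨y, hy, rfl⟩ ⟨z, hz, hzy⟩
    have h := fmapBranch_div (hg n y hy)
    rw [← hzy, fmapBranch_div (hh m z hz)] at h
    have hy' := hA' y hy
    have hz' := hA' z hz
    rcases le_or_gt n m with hnm | hnm
    · rify at hnm
      linarith [hy'.2, hz'.2]
    · have hnm' : (m : ℝ) + 1 ≤ n := by exact_mod_cast hnm
      linarith [hy'.1, hz'.1]
  have hpre := preimage_fmap_inter_Iirr hA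
  have hmeas := (MeasurableSet.iUnion hgm).union (MeasurableSet.iUnion hhm)
  rw [← mGauss_apply_inter_Iirr, mGauss_apply_of_subset (hpre ▸ hmeas) Set.inter_subset_right,
    mGauss_apply_of_subset hAm hA, hpre, lintegral_union (MeasurableSet.iUnion hhm) hd,
    lintegral_iUnion hgm hgd, lintegral_iUnion hhm hhd]
  simp only [setLIntegral_image_fmapBranch hAm abs_one (hg _),
    setLIntegral_image_fmapBranch hAm (abs_neg (1 : ℝ) ▸ abs_one) (hh _)]
  rw [← lintegral_tsum fun n => by fun_prop, ← lintegral_tsum fun n => by fun_prop,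
    ← lintegral_add_left (by fun_prop)]
  refine setLIntegral_congr_fun hAm fun y hy => ?_
  have hy' := hA' y hy
  have h1 : 0 < 1 - y := by linarith [hy'.2]
  have hcomb (n : ℕ) : (n + 1 : ℝ) + (-1) * y = n + (1 - y) := by ring
  simp only [one_mul, hcomb]
  rw [tsum_ofReal_one_div_sub_one_div hy'.1, tsum_ofReal_one_div_sub_one_div h1,
    ENNReal.ofReal_add (one_div_nonneg.2 hy'.1.le) (one_div_nonneg.2 h1.le)]
end
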